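/- Let G be a group generated by a finite set A, with word metric d_A and Gromov products (g|h)_p = ½(d_A(p,g) + d_A(p,h) − d_A(g,h)). Then G is virtually free if and only if there exists δ' ≥ 0 such that for every n ≥ 2 and all g₀, g₁, …, gₙ, p ∈ G one has (g₀|gₙ)_p ≥ min{(g₀|g₁)_p, …, (gₙ₋₁|gₙ)_p} − δ'. -/

import Mathlib

/-- The word metric associated with a generating set `A` of a group `G`:
`wordDist A g h` is the least `n` such that `g⁻¹h` is a product of `n` elements
of `A ∪ A⁻¹`. -/
noncomputable def wordDist {G : Type*} [Group G] (A : Set G) (g h : G) : ℕ :=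
  sInf { n : ℕ | ∃ l : List G, l.length = n ∧ (∀ x ∈ l, x ∈ A ∪ A⁻¹) ∧ l.prod = g⁻¹ * h }

/-- A group is virtually free if it has a free subgroup of finite index. -/
def VirtuallyFree (G : Type*) [Group G] : Prop :=
  ∃ H : Subgroup G, H.FiniteIndex ∧ IsFreeGroup H

/-- The Gromov product for the word metric `d_A`:
`(g|h)_p = ½(d_A(p,g) + d_A(p,h) − d_A(g,h))`. -/
noncomputable def gromovProdW {G : Type*} [Group G] (A : Set G) (p g h : G) : ℝ :=
  ((wordDist A p g : ℝ) + (wordDist A p h : ℝ) - (wordDist A g h : ℝ)) / 2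

section Auxiliary

open scoped Pointwise

section WordMetric

variable {G : Type*} [Group G] {A : Set G}

/-- The adjacency relation of the Cayley graph of `G` with respect to `A`. -/
def CayleyAdj (A : Set G) (x y : G) : Prop := x⁻¹ * y ∈ A ∪ A⁻¹

theorem CayleyAdj.symm {x y : G} (h : CayleyAdj A x y) : CayleyAdj A y x := by
  have : y⁻¹ * x = (x⁻¹ * y)⁻¹ := by group
  unfold CayleyAdj at *
  rw [this, Set.mem_union, Set.mem_inv, inv_inv, or_comm]
  simpa using h

theorem cayleyAdj_comm {x y : G} : CayleyAdj A x y ↔ CayleyAdj A y x :=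
  ⟨CayleyAdj.symm, CayleyAdj.symm⟩

theorem cayleyAdj_mul_left (g x y : G) : CayleyAdj A (g * x) (g * y) ↔ CayleyAdj A x y := by
  simp [CayleyAdj, mul_assoc]

theorem wordDist_mul_left (g x y : G) : wordDist A (g * x) (g * y) = wordDist A x y := by
  simp [wordDist, mul_assoc]

theorem wordDist_le_length {x y : G} {l : List G} (hl : ∀ a ∈ l, a ∈ A ∪ A⁻¹)
    (hp : l.prod = x⁻¹ * y) : wordDist A x y ≤ l.length :=
  Nat.sInf_le ⟨l, rfl, hl, hp⟩

theorem exists_list_length_eq_wordDist (hgen : Subgroup.closure A = ⊤) (x y : G) :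
    ∃ l : List G, l.length = wordDist A x y ∧ (∀ a ∈ l, a ∈ A ∪ A⁻¹) ∧ l.prod = x⁻¹ * y := by
  have hne : { n : ℕ | ∃ l : List G, l.length = n ∧ (∀ a ∈ l, a ∈ A ∪ A⁻¹) ∧
      l.prod = x⁻¹ * y }.Nonempty := by
    have hmem : x⁻¹ * y ∈ Submonoid.closure (A ∪ A⁻¹) := by
      rw [← Subgroup.closure_toSubmonoid, hgen]
      trivial
    obtain ⟨l, hl, hp⟩ := Submonoid.exists_list_of_mem_closure hmem
    exact ⟨l.length, l, rfl, hl, hp⟩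
  exact Nat.sInf_mem hne

theorem wordDist_self (x : G) : wordDist A x x = 0 :=
  Nat.le_zero.mp (wordDist_le_length (l := []) (by simp) (by simp))

theorem CayleyAdj.wordDist_le_one {x y : G} (h : CayleyAdj A x y) : wordDist A x y ≤ 1 :=
  wordDist_le_length (l := [x⁻¹ * y]) (by simpa [CayleyAdj] using h) (by simp)

theorem eq_of_wordDist_eq_zero (hgen : Subgroup.closure A = ⊤) {x y : G}
    (h : wordDist A x y = 0) : x = y := by
  obtain ⟨l, hl, -, hp⟩ := exists_list_length_eq_wordDist hgen x y
  rw [h, List.length_eq_zero_iff] at hl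
  subst hl
  simpa [eq_inv_mul_iff_mul_eq] using hp

theorem wordDist_triangle (hgen : Subgroup.closure A = ⊤) (x y z : G) :
    wordDist A x z ≤ wordDist A x y + wordDist A y z := by
  obtain ⟨l, hl, hlA, hlp⟩ := exists_list_length_eq_wordDist hgen x y
  obtain ⟨m, hm, hmA, hmp⟩ := exists_list_length_eq_wordDist hgen y z
  rw [← hl, ← hm, ← List.length_append]
  refine wordDist_le_length (fun a ha => ?_) (by rw [List.prod_append, hlp, hmp]; group)
  exact (List.mem_append.mp ha).elim (hlA a) (hmA a)

theorem wordDist_comm_le (hgen : Subgroup.closure A = ⊤) (x y : G) :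
    wordDist A x y ≤ wordDist A y x := by
  obtain ⟨l, hl, hlA, hlp⟩ := exists_list_length_eq_wordDist hgen y x
  have : wordDist A x y ≤ (l.map (·⁻¹)).reverse.length := by
    refine wordDist_le_length (fun a ha => ?_) (by rw [← List.prod_inv_reverse, hlp]; group)
    simp only [List.mem_reverse, List.mem_map] at ha
    obtain ⟨b, hb, rfl⟩ := ha
    rw [Set.mem_union, Set.mem_inv, inv_inv, or_comm]
    exact hlA b hb
  simpa [hl] using this

theorem wordDist_comm (hgen : Subgroup.closure A = ⊤) (x y : G) :
    wordDist A x y = wordDist A y x :=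
  le_antisymm (wordDist_comm_le hgen x y) (wordDist_comm_le hgen y x)

/-- Any two points are joined by a geodesic of the Cayley graph. -/
theorem exists_geodesic (hgen : Subgroup.closure A = ⊤) (x y : G) :
    ∃ γ : ℕ → G, γ 0 = x ∧ γ (wordDist A x y) = y ∧
      (∀ i ≤ wordDist A x y, wordDist A x (γ i) = i ∧
        wordDist A (γ i) y = wordDist A x y - i) ∧
      ∀ i < wordDist A x y, CayleyAdj A (γ i) (γ (i + 1)) := by
  obtain ⟨l, hl, hlA, hlp⟩ := exists_list_length_eq_wordDist hgen x y
  refine ⟨fun i => x * (l.take i).prod, by simp, by simp [← hl, hlp], fun i hi => ?_,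
    fun i hi => ?_⟩
  · have h1 : wordDist A x (x * (l.take i).prod) ≤ i :=
      (wordDist_le_length (l := l.take i) (fun a ha => hlA a (List.mem_of_mem_take ha))
        (by group)).trans (List.length_take_le _ _)
    have h2 : wordDist A (x * (l.take i).prod) y ≤ l.length - i :=
      (wordDist_le_length (l := l.drop i) (fun a ha => hlA a (List.mem_of_mem_drop ha))
        (by
          rw [mul_inv_rev, mul_assoc, ← hlp, eq_inv_mul_iff_mul_eq, List.prod_take_mul_prod_drop])
        ).trans (by simp)
    have h3 := wordDist_triangle hgen x (x * (l.take i).prod) y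
    dsimp only
    omega
  · rw [← hl] at hi
    have : (x * (l.take i).prod)⁻¹ * (x * (l.take (i + 1)).prod) = l[i] := by
      rw [List.prod_take_succ _ _ hi]
      group
    dsimp only [CayleyAdj]
    rw [this]
    exact hlA _ (List.getElem_mem hi)

theorem exists_wordDist_between (hgen : Subgroup.closure A = ⊤) (x y : G) {i : ℕ}
    (hi : i ≤ wordDist A x y) :
    ∃ z, wordDist A x z = i ∧ wordDist A z y = wordDist A x y - i :=
  let ⟨γ, _, _, h, _⟩ := exists_geodesic hgen x y
  ⟨γ i, h i hi⟩

theorem finite_cayleyAdj (hA : A.Finite) (x : G) : {y | CayleyAdj A x y}.Finite := by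
  refine ((hA.union hA.inv).image (x * ·)).subset fun y hy => ⟨x⁻¹ * y, hy, by simp⟩

theorem finite_wordDist_le (hA : A.Finite) (hgen : Subgroup.closure A = ⊤) (x : G) (n : ℕ) :
    {y | wordDist A x y ≤ n}.Finite := by
  induction n with
  | zero =>
    exact (Set.finite_singleton x).subset fun y hy =>
      (eq_of_wordDist_eq_zero hgen (Nat.le_zero.mp hy)).symm
  | succ n ih =>
    refine (ih.union (ih.biUnion fun z _ => finite_cayleyAdj hA z)).subset fun y hy => ?_
    rcases Nat.lt_or_ge n (wordDist A x y) with h | h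
    · obtain ⟨γ, -, hγ, h1, h2⟩ := exists_geodesic hgen x y
      have hy' : wordDist A x y = n + 1 := le_antisymm hy h
      refine Or.inr (Set.mem_biUnion (x := γ n) (by simp [h1 n h.le]) ?_)
      have := h2 n h
      rwa [← hy', hγ] at this
    · exact Or.inl h

/-- The vertices of a geodesic segment, with the induced path. -/
theorem reflTransGen_between (hgen : Subgroup.closure A = ⊤) (x y : G) :
    Relation.ReflTransGen (fun a b => CayleyAdj A a b ∧
      wordDist A x a + wordDist A a y = wordDist A x y ∧
      wordDist A x b + wordDist A b y = wordDist A x y) x y := by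
  obtain ⟨γ, h0, h1, h2, h3⟩ := exists_geodesic hgen x y
  have : ∀ i ≤ wordDist A x y, Relation.ReflTransGen (fun a b => CayleyAdj A a b ∧
      wordDist A x a + wordDist A a y = wordDist A x y ∧
      wordDist A x b + wordDist A b y = wordDist A x y) x (γ i) := by
    intro i hi
    induction i with
    | zero => rw [h0]
    | succ i ih =>
      refine (ih (by omega)).tail ⟨h3 i hi, ?_, ?_⟩
      · have := h2 i (by omega); omega
      · have := h2 (i + 1) hi; omega
  simpa [h1] using this _ le_rfl

theorem exists_seq_of_reflTransGen {α : Type*} {r : α → α → Prop} {x y : α}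
    (h : Relation.ReflTransGen r x y) :
    ∃ (n : ℕ) (g : ℕ → α), g 0 = x ∧ g n = y ∧ ∀ i < n, r (g i) (g (i + 1)) := by
  induction h using Relation.ReflTransGen.head_induction_on with
  | refl => exact ⟨0, fun _ => y, rfl, rfl, by simp⟩
  | @head a b hab _ ih =>
    obtain ⟨n, g, h0, hn, hr⟩ := ih
    refine ⟨n + 1, fun i => Nat.casesOn i a g, rfl, hn, fun i hi => ?_⟩
    cases i with
    | zero => simpa [h0] using hab
    | succ i => exact hr i (by omega)

theorem reflTransGen_and_mem {α : Type*} {r : α → α → Prop} {T : Set α} {x y : α}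
    (h : Relation.ReflTransGen (fun a b => r a b ∧ b ∈ T) x y) (hx : x ∈ T) :
    Relation.ReflTransGen (fun a b => r a b ∧ a ∈ T ∧ b ∈ T) x y ∧ y ∈ T := by
  induction h with
  | refl => exact ⟨.refl, hx⟩
  | tail _ hbc ih => exact ⟨ih.1.tail ⟨hbc.1, ih.2, hbc.2⟩, hbc.2⟩

/-- The bottleneck property with constant `c`: a path joining the endpoints of a geodesic
passes within distance `c` of every point of the geodesic. -/
def Bottleneck (A : Set G) (c : ℕ) : Prop :=
  ∀ (x y z : G) (T : Set G), wordDist A x z + wordDist A z y = wordDist A x y → x ∈ T →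
    Relation.ReflTransGen (fun a b => CayleyAdj A a b ∧ b ∈ T) x y →
      ∃ w ∈ T, wordDist A z w ≤ c

end WordMetric

section Gromov

variable {G : Type*} [Group G] {A : Set G}

theorem gromovProdW_le_of_between (hgen : Subgroup.closure A = ⊤) {p a b w : G}
    (hw : wordDist A a w + wordDist A w b = wordDist A a b) :
    gromovProdW A p a b ≤ wordDist A p w := by
  have h1 := wordDist_triangle hgen p w a
  have h2 := wordDist_triangle hgen p w b
  rw [wordDist_comm hgen w a] at h1
  have h3 : (wordDist A p a + wordDist A p b : ℝ) ≤ 2 * wordDist A p w + wordDist A a b := by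
    exact_mod_cast (by omega :
      wordDist A p a + wordDist A p b ≤ 2 * wordDist A p w + wordDist A a b)
  unfold gromovProdW
  linarith

/-- The Gromov inequality for chains implies the bottleneck property. -/
theorem bottleneck_of_gromov_inequality (hgen : Subgroup.closure A = ⊤) {δ : ℝ}
    (h : ∀ (n : ℕ) (hn : (Finset.range n).Nonempty), 2 ≤ n → ∀ (g : ℕ → G) (p : G),
        ((Finset.range n).inf' hn fun i => gromovProdW A p (g i) (g (i + 1))) - δ
          ≤ gromovProdW A p (g 0) (g n)) :
    Bottleneck A (⌈δ⌉₊) := by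
  intro x y z T hz hx hpath
  obtain ⟨n, g, h0, hn, hr⟩ := exists_seq_of_reflTransGen hpath
  by_contra! hT
  have hgT : ∀ i ≤ n, ⌈δ⌉₊ + 1 ≤ wordDist A z (g i) := by
    intro i hi
    cases i with
    | zero => exact hT _ (h0 ▸ hx)
    | succ i => exact hT _ (hr i hi).2
  have key := h (n + 2) (Finset.nonempty_range_add_one) (by omega) (fun i => g (min i n)) z
  have h1 : gromovProdW A z (g (min 0 n)) (g (min (n + 2) n)) = 0 := by
    have : (wordDist A x z + wordDist A z y : ℝ) = wordDist A x y := by exact_mod_cast hz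
    rw [Nat.zero_min, min_eq_right (by omega), h0, hn, gromovProdW, wordDist_comm hgen z x]
    linarith
  rw [h1] at key
  have h2 : δ < ((Finset.range (n + 2)).inf' Finset.nonempty_range_add_one
      fun i => gromovProdW A z (g (min i n)) (g (min (i + 1) n))) := by
    rw [Finset.lt_inf'_iff]
    intro i _
    have hd : wordDist A (g (min i n)) (g (min (i + 1) n)) ≤ 1 := by
      rcases Nat.lt_or_ge i n with hi | hi
      · rw [min_eq_left hi.le, min_eq_left hi]
        exact (hr i hi).1.wordDist_le_one
      · rw [min_eq_right hi, min_eq_right (by omega), wordDist_self]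
        exact zero_le_one
    have ha := hgT (min i n) (by omega)
    have hb := hgT (min (i + 1) n) (by omega)
    have hsum : ((2 * ⌈δ⌉₊ + 1 + wordDist A (g (min i n)) (g (min (i + 1) n)) : ℕ) : ℝ) ≤
        ((wordDist A z (g (min i n)) + wordDist A z (g (min (i + 1) n)) : ℕ) : ℝ) := by
      exact_mod_cast (by omega)
    push_cast at hsum
    have := Nat.le_ceil δ
    unfold gromovProdW
    linarith
  linarith

theorem reflTransGen_chain (hgen : Subgroup.closure A = ⊤) {p : G} {r : ℝ} {g : ℕ → G} {n : ℕ}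
    (hr : ∀ i < n, r ≤ gromovProdW A p (g i) (g (i + 1))) :
    Relation.ReflTransGen (fun a b => CayleyAdj A a b ∧ b ∈ {w | r ≤ wordDist A p w})
      (g 0) (g n) := by
  induction n with
  | zero => exact .refl
  | succ n ih =>
    refine (ih fun i hi => hr i (by omega)).trans ?_
    refine Relation.ReflTransGen.mono ?_ _ _ (reflTransGen_between hgen (g n) (g (n + 1)))
    rintro a b ⟨hab, -, hb⟩
    exact ⟨hab, (hr n (by omega)).trans (gromovProdW_le_of_between hgen hb)⟩

/-- In a space with the bottleneck property some point of a geodesic is nearly as close to `p`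
as the Gromov product of the endpoints. -/
theorem Bottleneck.exists_le_gromovProdW (hgen : Subgroup.closure A = ⊤) {c : ℕ}
    (hb : Bottleneck A c) (p x y : G) :
    ∃ z, wordDist A x z + wordDist A z y = wordDist A x y ∧
      (wordDist A p z : ℝ) - (2 * c + 1) ≤ gromovProdW A p x y := by
  obtain ⟨γ, h0, hm, hγ, hadj⟩ := exists_geodesic hgen x y
  set m := wordDist A x y with hmdef
  let S₁ : ℕ → Prop := fun j =>
    ∃ w, wordDist A x w + wordDist A w p = wordDist A x p ∧ wordDist A (γ j) w ≤ c
  let S₂ : ℕ → Prop := fun j =>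
    ∃ w, wordDist A p w + wordDist A w y = wordDist A p y ∧ wordDist A (γ j) w ≤ c
  have hS : ∀ j ≤ m, S₁ j ∨ S₂ j := by
    intro j hj
    obtain ⟨w, hw, hwc⟩ := hb x y (γ j) {w | wordDist A x w + wordDist A w p = wordDist A x p ∨
        wordDist A p w + wordDist A w y = wordDist A p y}
      (by have := hγ j hj; omega) (by simp [wordDist_self])
      ((Relation.ReflTransGen.mono (fun a b h => ⟨h.1, Or.inl h.2.2⟩) _ _
          (reflTransGen_between hgen x p)).trans
        (Relation.ReflTransGen.mono (fun a b h => ⟨h.1, Or.inr h.2.2⟩) _ _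
          (reflTransGen_between hgen p y)))
    exact hw.imp (fun h => ⟨w, h, hwc⟩) (fun h => ⟨w, h, hwc⟩)
  have hS₁ : S₁ 0 := ⟨x, by simp [wordDist_self], by simp [h0, wordDist_self]⟩
  have hS₂ : S₂ m := ⟨y, by simp [wordDist_self], by simp [hm, wordDist_self]⟩
  obtain ⟨j, hj, h1, k, hk, hjk, h2⟩ :
      ∃ j ≤ m, S₁ j ∧ ∃ k ≤ m, wordDist A (γ j) (γ k) ≤ 1 ∧ S₂ k := by
    by_contra! hcon
    have hall : ∀ j ≤ m, S₁ j := by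
      intro j hj
      induction j with
      | zero => exact hS₁
      | succ j ih =>
        refine (hS (j + 1) hj).resolve_right ?_
        exact hcon j (by omega) (ih (by omega)) (j + 1) hj (hadj j hj).wordDist_le_one
    exact hcon m le_rfl (hall m le_rfl) m le_rfl (by simp [wordDist_self]) hS₂
  refine ⟨γ j, by have := hγ j hj; omega, ?_⟩
  obtain ⟨w, hw, hwc⟩ := h1
  obtain ⟨w', hw', hwc'⟩ := h2
  have e := hγ j hj
  have t1 := wordDist_triangle hgen x w (γ j)
  have t2 := wordDist_triangle hgen p w (γ j)
  have t3 := wordDist_triangle hgen p w' (γ j)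
  have t4 := wordDist_triangle hgen (γ j) w' y
  have t5 := wordDist_triangle hgen w' (γ k) (γ j)
  have t6 := wordDist_triangle hgen (γ j) (γ k) w'
  rw [wordDist_comm hgen p w] at t2
  rw [wordDist_comm hgen (γ k) (γ j), wordDist_comm hgen w' (γ k)] at t5
  rw [wordDist_comm hgen w (γ j)] at t1 t2
  have hcomm := wordDist_comm hgen x p
  have : ((2 * wordDist A p (γ j) + m : ℕ) : ℝ) ≤
      ((wordDist A p x + wordDist A p y + (4 * c + 2) : ℕ) : ℝ) := by
    exact_mod_cast (by omega)
  push_cast at this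
  unfold gromovProdW
  linarith

/-- The bottleneck property implies the Gromov inequality for chains. -/
theorem Bottleneck.gromov_inequality (hgen : Subgroup.closure A = ⊤) {c : ℕ}
    (hb : Bottleneck A c) {n : ℕ} (hn : (Finset.range n).Nonempty) (g : ℕ → G) (p : G) :
    ((Finset.range n).inf' hn fun i => gromovProdW A p (g i) (g (i + 1))) - (3 * c + 1) ≤
      gromovProdW A p (g 0) (g n) := by
  set r := (Finset.range n).inf' hn fun i => gromovProdW A p (g i) (g (i + 1)) with hrdef
  have hr : ∀ i < n, r ≤ gromovProdW A p (g i) (g (i + 1)) := fun i hi =>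
    Finset.inf'_le (fun i => gromovProdW A p (g i) (g (i + 1))) (Finset.mem_range.mpr hi)
  have h0 : g 0 ∈ {w | r ≤ wordDist A p w} :=
    (hr 0 (Nat.pos_of_ne_zero (by simpa using hn))).trans
      (gromovProdW_le_of_between hgen (by simp [wordDist_self]))
  obtain ⟨z, hz, hpz⟩ := hb.exists_le_gromovProdW hgen p (g 0) (g n)
  obtain ⟨w, hw, hwc⟩ := hb _ _ z _ hz h0 (reflTransGen_chain hgen hr)
  have ht : (wordDist A p w : ℝ) ≤ wordDist A p z + wordDist A z w := by
    exact_mod_cast wordDist_triangle hgen p z w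
  have hwc' : (wordDist A z w : ℝ) ≤ c := by exact_mod_cast hwc
  have hw' : r ≤ wordDist A p w := hw
  linarith

end Gromov

section TreeLike

variable {G : Type*} [Group G] {A : Set G}

/-- A Cayley graph that is coarsely embedded in a `0`-hyperbolic space has the bottleneck
property. -/
theorem bottleneck_of_treelike (hgen : Subgroup.closure A = ⊤) {D : G → G → ℕ} {L : ℕ}
    (hself : ∀ x, D x x = 0) (hcomm : ∀ x y, D x y = D y x)
    (htri : ∀ x y z, D x z ≤ D x y + D y z)
    (hultra : ∀ z a b c, min ((D z a : ℤ) + D z b - D a b) ((D z b : ℤ) + D z c - D b c) ≤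
      (D z a : ℤ) + D z c - D a c)
    (hL : ∀ x y, CayleyAdj A x y → D x y ≤ L)
    (hproper : ∀ R, ∃ ρ, ∀ x y, D x y ≤ R → wordDist A x y ≤ ρ) :
    ∃ c, Bottleneck A c := by
  obtain ⟨ρ, hρ⟩ := hproper (2 * L)
  obtain ⟨c, hc⟩ := hproper (2 * L + L * ρ)
  have hLip : ∀ x y, D x y ≤ L * wordDist A x y := by
    intro x y
    obtain ⟨γ, h0, h1, -, h3⟩ := exists_geodesic hgen x y
    have : ∀ i ≤ wordDist A x y, D x (γ i) ≤ L * i := by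
      intro i hi
      induction i with
      | zero => simp [h0, hself]
      | succ i ih =>
        have := htri x (γ i) (γ (i + 1))
        have := hL _ _ (h3 i hi)
        have := ih (by omega)
        rw [mul_add]
        omega
    simpa [h1] using this _ le_rfl
  -- Gromov products along a path that stays far from `z`
  have hchain : ∀ (z : G) (t : ℤ) (x y : G),
      Relation.ReflTransGen (fun a b => CayleyAdj A a b ∧ t ≤ 2 * D z a) x y →
      x = y ∨ t - 2 * L ≤ (D z x : ℤ) + D z y - D x y := by
    intro z t x y h
    induction h with
    | refl => exact Or.inl rfl
    | @tail b b' _ hbb' ih =>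
      right
      have h1 := htri z b' b
      have h2 := hL _ _ hbb'.1
      have h3 := hcomm b b'
      have h4 := hbb'.2
      rcases ih with rfl | ih
      · omega
      · have h5 := hultra z x b b'
        omega
  -- the first point of a geodesic from `x` to `z` that is close to `z`
  have hfirst : ∀ (z x : G) (P : ℤ), 0 ≤ P → P ≤ 2 * D z x →
      ∃ u, wordDist A x u + wordDist A u z = wordDist A x z ∧ 2 * (D z u : ℤ) ≤ P ∧
        P - 2 * L ≤ (D z x : ℤ) + D z u - D x u := by
    intro z x P hP hPx
    obtain ⟨γ, h0, h1, h2, h3⟩ := exists_geodesic hgen x z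
    have hex : ∃ i, i ≤ wordDist A x z ∧ 2 * (D z (γ i) : ℤ) ≤ P :=
      ⟨_, le_rfl, by simpa [h1, hself] using hP⟩
    classical
    obtain ⟨hi, hiP⟩ := Nat.find_spec hex
    refine ⟨γ (Nat.find hex), by have := h2 _ hi; omega, hiP, ?_⟩
    have hpath : ∀ i ≤ Nat.find hex, Relation.ReflTransGen
        (fun a b => CayleyAdj A a b ∧ P ≤ 2 * D z a) x (γ i) := by
      intro i hi'
      induction i with
      | zero => rw [h0]
      | succ i ih =>
        refine (ih (by omega)).tail ⟨h3 i (by omega), ?_⟩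
        have := Nat.find_min hex hi'
        simp only [not_and, not_le] at this
        exact (this (by omega)).le
    rcases hchain z P _ _ (hpath _ le_rfl) with h | h
    · rw [← h]
      simp only [hself]
      omega
    · exact h
  refine ⟨c, fun x y z T hz hx hpath => ?_⟩
  set P : ℤ := (D z x : ℤ) + D z y - D x y with hP
  have hPnonneg : 0 ≤ P := by
    have := htri x z y
    have := hcomm x z
    omega
  obtain ⟨u, hu, huP, hu'⟩ := hfirst z x P hPnonneg (by
    have := htri z x y
    omega)
  obtain ⟨v, hv, hvP, hv'⟩ := hfirst z y P hPnonneg (by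
    have := htri z y x
    have := hcomm x y
    omega)
  have huv : D u v ≤ 2 * L := by
    have h1 := hultra z u x y
    have h2 := hultra z u y v
    have h3 := hcomm u x
    omega
  have huz : wordDist A u z ≤ ρ := by
    have h1 := hρ u v huv
    have h2 := wordDist_triangle hgen x u y
    have h3 := wordDist_triangle hgen u v y
    rw [wordDist_comm hgen v y] at h3
    rw [wordDist_comm hgen v z, wordDist_comm hgen y z] at hv
    have h4 := wordDist_comm hgen v z
    omega
  have hzu : D z u ≤ L * ρ := by
    refine (hLip z u).trans (Nat.mul_le_mul_left _ ?_)
    rwa [wordDist_comm hgen]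
  have hPle : P ≤ 2 * L + 2 * (L * ρ : ℕ) := by
    have := htri z u x
    have := hcomm u x
    omega
  by_contra! hT
  have hfar : ∀ w ∈ T, P + 2 * L < 2 * D z w := by
    intro w hw
    by_contra! hcon
    have := hc z w (by omega)
    exact absurd this (not_le.mpr (hT w hw))
  have hpath' : x = y ∨ (P + 2 * L + 1) - 2 * L ≤ (D z x : ℤ) + D z y - D x y := by
    refine hchain z _ x y (Relation.ReflTransGen.mono ?_ _ _ (reflTransGen_and_mem hpath hx).1)
    rintro a b ⟨hab, ha, -⟩
    exact ⟨hab, hfar a ha⟩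
  rcases hpath' with rfl | h
  · have := hfar x hx
    have := hself x
    omega
  · omega

end TreeLike

section FreeGroup

theorem List.exists_append_head_ne {α : Type*} [DecidableEq α] (l m : List α) :
    ∃ p l' m', l = p ++ l' ∧ m = p ++ m' ∧ ∀ x ∈ l'.head?, ∀ y ∈ m'.head?, x ≠ y := by
  induction l generalizing m with
  | nil => exact ⟨[], [], m, by simp⟩
  | cons a l ih =>
    cases m with
    | nil => exact ⟨[], a :: l, [], by simp⟩
    | cons b m =>
      by_cases hab : a = b
      · obtain ⟨p, l', m', h1, h2, h3⟩ := ih m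
        exact ⟨a :: p, l', m', by simp [h1], by simp [h2, hab], h3⟩
      · exact ⟨[], a :: l, b :: m, by simp [hab]⟩

namespace FreeGroup

theorem finite_of_fg {ι : Type*} [Group.FG (FreeGroup ι)] : Finite ι := by
  classical
  obtain ⟨S, hS⟩ := Group.fg_def.mp ‹Group.FG (FreeGroup ι)›
  have hmem : ∀ x : FreeGroup ι, ∃ F : Finset ι, x ∈ Subgroup.closure (of '' (F : Set ι)) := by
    intro x
    induction x using FreeGroup.induction_on with
    | C1 => exact ⟨∅, one_mem _⟩
    | of i => exact ⟨{i}, Subgroup.subset_closure ⟨i, by simp⟩⟩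
    | inv_of i h => exact h.imp fun F hF => inv_mem hF
    | mul x y hx hy =>
      obtain ⟨F, hF⟩ := hx
      obtain ⟨F', hF'⟩ := hy
      refine ⟨F ∪ F', mul_mem (Subgroup.closure_mono ?_ hF) (Subgroup.closure_mono ?_ hF')⟩ <;>
      exact Set.image_mono (by simp)
  choose F hF using hmem
  let F₀ : Finset ι := S.biUnion F
  have htop : Subgroup.closure (of '' (F₀ : Set ι)) = ⊤ := by
    rw [eq_top_iff, ← hS, Subgroup.closure_le]
    intro s hs
    refine Subgroup.closure_mono (Set.image_mono ?_) (hF s)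
    exact_mod_cast Finset.subset_biUnion_of_mem F hs
  refine Finite.of_surjective (fun x : F₀ => (x : ι)) ?_
  intro i
  by_contra! hi
  let φ : FreeGroup ι →* Multiplicative ℤ :=
    FreeGroup.lift fun j => if j = i then Multiplicative.ofAdd 1 else 1
  have hφ : Subgroup.closure (of '' (F₀ : Set ι)) ≤ φ.ker := by
    rw [Subgroup.closure_le]
    rintro _ ⟨j, hj, rfl⟩
    have : j ≠ i := hi ⟨j, hj⟩
    simp [φ, this]
  have : of i ∈ φ.ker := hφ (htop ▸ Subgroup.mem_top _)
  simp [φ] at this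

variable {ι : Type*} [DecidableEq ι]

theorem norm_inv_mul_le_of_toWord_eq_append {a b : FreeGroup ι} {p l m : List (ι × Bool)}
    (ha : a.toWord = p ++ l) (hb : b.toWord = p ++ m) :
    norm (a⁻¹ * b) ≤ l.length + m.length := by
  have : a⁻¹ * b = mk (invRev l ++ m) := by
    rw [← mk_toWord (x := a), ← mk_toWord (x := b), ha, hb, ← mul_mk, ← mul_mk, ← mul_mk,
      ← inv_mk]
    group
  rw [this]
  exact norm_mk_le.trans (by simp)

theorem exists_toWord_eq_append (a b : FreeGroup ι) :
    ∃ p l m : List (ι × Bool), a.toWord = p ++ l ∧ b.toWord = p ++ m ∧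
      norm (a⁻¹ * b) = l.length + m.length := by
  obtain ⟨p, l, m, ha, hb, hne⟩ := List.exists_append_head_ne a.toWord b.toWord
  refine ⟨p, l, m, ha, hb, ?_⟩
  have hl : IsReduced l :=
    (List.isChain_append.mp (ha ▸ isReduced_toWord (x := a) : IsReduced (p ++ l))).2.1
  have hm : IsReduced m :=
    (List.isChain_append.mp (hb ▸ isReduced_toWord (x := b) : IsReduced (p ++ m))).2.1
  have hl' : IsReduced (invRev l) := by
    have h1 : (mk l).toWord = l := by rw [toWord_mk, hl.reduce_eq]
    rw [← h1, ← toWord_inv]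
    exact isReduced_toWord
  have hred : IsReduced (invRev l ++ m) := by
    refine List.isChain_append.mpr ⟨hl', hm, ?_⟩
    intro x hx y hy hxy
    simp only [invRev, List.getLast?_reverse, List.head?_map, Option.mem_def,
      Option.map_eq_some_iff] at hx
    obtain ⟨z, hz, rfl⟩ := hx
    have := hne z hz y hy
    rcases z with ⟨z, _ | _⟩ <;> rcases y with ⟨y, _ | _⟩ <;> simp_all
  have : a⁻¹ * b = mk (invRev l ++ m) := by
    rw [← mk_toWord (x := a), ← mk_toWord (x := b), ha, hb, ← mul_mk, ← mul_mk, ← mul_mk,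
      ← inv_mk]
    group
  rw [this, norm, toWord_mk, hred.reduce_eq]
  simp

/-- The word metric of a free basis is `0`-hyperbolic. -/
theorem min_gromov_le (z a b c : FreeGroup ι) :
    min ((norm (z⁻¹ * a) : ℤ) + norm (z⁻¹ * b) - norm (a⁻¹ * b))
      ((norm (z⁻¹ * b) : ℤ) + norm (z⁻¹ * c) - norm (b⁻¹ * c)) ≤
      (norm (z⁻¹ * a) : ℤ) + norm (z⁻¹ * c) - norm (a⁻¹ * c) := by
  have hz : ∀ x y : FreeGroup ι, x⁻¹ * y = (z⁻¹ * x)⁻¹ * (z⁻¹ * y) := fun x y => by group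
  rw [hz a b, hz b c, hz a c]
  generalize z⁻¹ * a = a
  generalize z⁻¹ * b = b
  generalize z⁻¹ * c = c
  obtain ⟨p, l, m, ha, hb, h⟩ := exists_toWord_eq_append a b
  obtain ⟨p', l', m', hb', hc, h'⟩ := exists_toWord_eq_append b c
  rw [h, h']
  simp only [norm, ha, hb, hc, List.length_append]
  have hlen : p.length + m.length = p'.length + l'.length := by
    rw [← List.length_append, ← List.length_append, ← hb, hb']
  have hbb : p ++ m = p' ++ l' := hb.symm.trans hb'
  rcases List.append_eq_append_iff.mp hbb with ⟨q, rfl, rfl⟩ | ⟨q, rfl, rfl⟩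
  · have := norm_inv_mul_le_of_toWord_eq_append (a := a) (b := c) (p := p) (l := l)
      (m := q ++ m') ha (by rw [hc, List.append_assoc])
    simp only [norm, List.length_append] at *
    omega
  · have := norm_inv_mul_le_of_toWord_eq_append (a := a) (b := c) (p := p') (l := q ++ l)
      (m := m') (by rw [ha, List.append_assoc]) hc
    simp only [norm, List.length_append] at *
    omega

theorem finite_norm_le [Finite ι] (n : ℕ) : {x : FreeGroup ι | norm x ≤ n}.Finite :=
  (List.finite_length_le (ι × Bool) n).preimage (toWord_injective.injOn)

end FreeGroup

end FreeGroup

section VirtuallyFree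

variable {G : Type*} [Group G] {A : Set G}

theorem VirtuallyFree.bottleneck (hA : A.Finite) (hgen : Subgroup.closure A = ⊤)
    (hG : VirtuallyFree G) : ∃ c, Bottleneck A c := by
  classical
  obtain ⟨H, hfin, hfree⟩ := hG
  have hGfg : Group.FG G := ⟨⟨hA.toFinset, by simpa using hgen⟩⟩
  have hHfg : Group.FG H := H.fg_of_index_ne_zero
  let e := IsFreeGroup.toFreeGroup H
  have hFfg : Group.FG (FreeGroup (IsFreeGroup.Generators H)) :=
    Group.fg_of_surjective (f := e.toMonoidHom) e.surjective
  have hι : Finite (IsFreeGroup.Generators H) := FreeGroup.finite_of_fg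
  have hQ : Finite (G ⧸ H) := H.finite_quotient_of_finiteIndex
  let t : G → G := fun g => ((g⁻¹ : G) : G ⧸ H).out
  have ht : ∀ g, g * t g ∈ H := by
    intro g
    obtain ⟨h, hh⟩ := QuotientGroup.mk_out_eq_mul H g⁻¹
    simp only [t, hh, mul_inv_cancel_left]
    exact h.2
  let S : Set G := Set.range (Quotient.out : G ⧸ H → G)
  have hS : S.Finite := Set.finite_range _
  have htS : ∀ g, t g ∈ S := fun g => ⟨_, rfl⟩
  let f : G → H := fun g => ⟨g * t g, ht g⟩
  have hf : ∀ x y, (((f x)⁻¹ * f y : H) : G) = (t x)⁻¹ * (x⁻¹ * y) * t y := by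
    intro x y
    simp only [f, Subgroup.coe_mul, Subgroup.coe_inv]
    group
  let D : G → G → ℕ := fun x y => FreeGroup.norm ((e (f x))⁻¹ * e (f y))
  have hD : ∀ x y, D x y = FreeGroup.norm (e ((f x)⁻¹ * f y)) := fun x y => by simp [D]
  have hDfin : ∃ L, ∀ x y, CayleyAdj A x y → D x y ≤ L := by
    have hT : (Set.image2 (fun p b => p.1⁻¹ * p.2 * b)
        (S ×ˢ (A ∪ A⁻¹)) S).Finite := (hS.prod (hA.union hA.inv)).image2 _ hS
    have hT' := (hT.preimage (Subtype.val_injective (p := (· ∈ H))).injOn).image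
      (fun h : H => FreeGroup.norm (e h))
    obtain ⟨L, hL⟩ := hT'.bddAbove
    refine ⟨L, fun x y hxy => ?_⟩
    rw [hD]
    refine hL ⟨_, ?_, rfl⟩
    rw [Set.mem_preimage, hf]
    exact ⟨(t x, x⁻¹ * y), ⟨htS x, hxy⟩, t y, htS y, rfl⟩
  obtain ⟨L, hL⟩ := hDfin
  refine bottleneck_of_treelike (D := D) (L := L) hgen ?_ ?_ ?_ ?_ hL ?_
  · intro x
    simp [D]
  · intro x y
    simp only [D]
    rw [← FreeGroup.norm_inv_eq]
    simp
  · intro x y z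
    simp only [D]
    have : (e (f x))⁻¹ * e (f z) = ((e (f x))⁻¹ * e (f y)) * ((e (f y))⁻¹ * e (f z)) := by group
    rw [this]
    exact FreeGroup.norm_mul_le _ _
  · intro z a b c
    exact FreeGroup.min_gromov_le _ _ _ _
  · intro R
    have hW : ((fun h : H => e h) ⁻¹' {x | FreeGroup.norm x ≤ R}).Finite :=
      (FreeGroup.finite_norm_le R).preimage e.injective.injOn
    have hT := (((hS.prod hS).image2 (fun (p : G × G) (w : H) => p.1 * (w : G) * p.2⁻¹) hW).image
      (fun g => wordDist A 1 g))
    obtain ⟨ρ, hρ⟩ := hT.bddAbove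
    refine ⟨ρ, fun x y hxy => ?_⟩
    have : wordDist A x y = wordDist A 1 (x⁻¹ * y) := by
      rw [← wordDist_mul_left x 1]
      simp
    rw [this]
    refine hρ ⟨_, ⟨(t x, t y), ⟨htS x, htS y⟩, (f x)⁻¹ * f y, ?_, ?_⟩, rfl⟩
    · simpa [D] using hxy
    · dsimp only
      rw [hf]
      group

end VirtuallyFree

/-- A discrete nested pocset with complementation `c`, whose associated tree is rooted: `out D`
says that the half-space `D` does not contain the root. -/
structure IsTreePocset {P : Type*} [PartialOrder P] (c : P → P) (out : P → Prop) : Prop where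
  compl_compl : ∀ D, c (c D) = D
  compl_le : ∀ {D E}, D ≤ E → c E ≤ c D
  nested : ∀ D E, D ≤ E ∨ D ≤ c E ∨ c D ≤ E ∨ c D ≤ c E
  not_le_compl : ∀ {D E}, D ≤ E → ¬ D ≤ c E
  out_compl : ∀ D, out (c D) ↔ ¬ out D
  out_of_le : ∀ {D E}, D ≤ E → out E → out D
  finite_out : ∀ D, out D → {F | out F ∧ D ≤ F}.Finite
  finite_Icc : ∀ D E : P, (Set.Icc D E).Finite

namespace IsTreePocset

variable {P : Type*} [PartialOrder P] {c : P → P} {out : P → Prop}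

/-- An orientation chooses one of `F` and `c F` for each `F`, compatibly with the order. -/
structure IsOrientation (c : P → P) (v : Set P) : Prop where
  compl_mem : ∀ F, c F ∈ v ↔ F ∉ v
  mem_of_le : ∀ {F F'}, F ∈ v → F ≤ F' → F' ∈ v

/-- The vertex of the associated tree at which the oriented edge `D` ends, regarded as the set of
half-spaces that contain it. -/
def vertex (c : P → P) (D : P) : Set P := {F | D ≤ F ∨ c D < F}

/-- The root of the tree. -/
def root (out : P → Prop) : Set P := {F | ¬ out F}

theorem IsOrientation.eq_of_subset {v w : Set P} (hv : IsOrientation c v)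
    (hw : IsOrientation c w) (h : v ⊆ w) : v = w := by
  refine h.antisymm fun F hF => ?_
  by_contra hFv
  exact (hw.compl_mem F).mp (h ((hv.compl_mem F).mpr hFv)) hF

theorem self_mem_vertex (D : P) : D ∈ vertex c D := Or.inl le_rfl

theorem le_compl_comm (h : IsTreePocset c out) {D E : P} : D ≤ c E ↔ E ≤ c D := by
  constructor <;> intro hDE
  · simpa [h.compl_compl] using h.compl_le hDE
  · simpa [h.compl_compl] using h.compl_le hDE

theorem compl_le_comm (h : IsTreePocset c out) {D E : P} : c D ≤ E ↔ c E ≤ D := by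
  constructor <;> intro hDE
  · simpa [h.compl_compl] using h.compl_le hDE
  · simpa [h.compl_compl] using h.compl_le hDE

theorem compl_le_compl (h : IsTreePocset c out) {D E : P} : c D ≤ c E ↔ E ≤ D :=
  ⟨fun hDE => by simpa [h.compl_compl] using h.compl_le hDE, h.compl_le⟩

theorem compl_inj (h : IsTreePocset c out) {D E : P} : c D = c E ↔ D = E :=
  ⟨fun hDE => by rw [← h.compl_compl D, hDE, h.compl_compl], fun hDE => hDE ▸ rfl⟩

theorem not_compl_le (h : IsTreePocset c out) {D E : P} (hDE : D ≤ E) : ¬ c D ≤ E := by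
  rw [← h.compl_le_compl] at hDE
  rw [h.compl_le_comm]
  simpa [h.compl_compl] using h.not_le_compl hDE

theorem isOrientation_root (h : IsTreePocset c out) : IsOrientation c (root out) where
  compl_mem F := not_congr (h.out_compl F)
  mem_of_le hF hFF' hF' := hF (h.out_of_le hFF' hF')

theorem isOrientation_vertex (h : IsTreePocset c out) (D : P) : IsOrientation c (vertex c D) where
  compl_mem F := by
    have key : F ∈ vertex c D → c F ∉ vertex c D := by
      rintro (hF | hF) (hF' | hF')
      · exact h.not_le_compl hF hF'
      · exact hF'.not_ge (h.compl_le hF)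
      · exact hF.not_ge (h.le_compl_comm.mp hF')
      · exact h.not_le_compl hF.le hF'.le
    refine ⟨fun hF hF' => key hF' hF, fun hF => ?_⟩
    simp only [vertex, Set.mem_ofPred_eq, not_or] at hF ⊢
    rcases h.nested D F with h1 | h1 | h1 | h1
    · exact absurd h1 hF.1
    · exact Or.inl h1
    · rcases h1.eq_or_lt with h2 | h2
      · left
        rw [← h2, h.compl_compl]
      · exact absurd h2 hF.2
    · rcases h1.eq_or_lt with h2 | h2
      · exact absurd (h.compl_inj.mp h2).le hF.1
      · exact Or.inr h2
  mem_of_le := by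
    rintro F F' (hF | hF) hFF'
    · exact Or.inl (hF.trans hFF')
    · exact Or.inr (hF.trans_le hFF')

theorem eq_of_mem_vertex_of_le (h : IsTreePocset c out) {D F : P} (hF : F ∈ vertex c D)
    (hFD : F ≤ D) : F = D := by
  rcases hF with hF | hF
  · exact hFD.antisymm hF
  · exact absurd (hF.le.trans hFD) (h.not_compl_le le_rfl)

theorem eq_vertex_of_minimal (h : IsTreePocset c out) {v : Set P} (hv : IsOrientation c v)
    {E : P} (hE : E ∈ v)
    (hmin : ∀ F ∈ v, F ≤ E → F = E) : v = vertex c E := by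
  refine hv.eq_of_subset (h.isOrientation_vertex E) fun F hF => ?_
  rcases h.nested E F with h1 | h1 | h1 | h1
  · exact Or.inl h1
  · exact absurd hF ((hv.compl_mem F).mp (hv.mem_of_le hE h1))
  · refine Or.inr (lt_of_le_of_ne h1 fun h2 => ?_)
    exact absurd hE ((hv.compl_mem E).mp (h2 ▸ hF))
  · exact Or.inl (hmin F hF (h.compl_le_compl.mp h1)).ge

theorem compl_mem_vertex_iff (h : IsTreePocset c out) {D F : P} :
    c F ∈ vertex c D ↔ F ∉ vertex c D :=
  (h.isOrientation_vertex D).compl_mem F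

theorem ne_compl (h : IsTreePocset c out) (D : P) : c D ≠ D :=
    fun hD => h.not_compl_le (le_refl D) hD.le

theorem vertex_compl (h : IsTreePocset c out) (D : P) :
    vertex c (c D) = insert (c D) (vertex c D \ {D}) := by
  symm
  refine h.eq_vertex_of_minimal ⟨fun F => ?_, ?_⟩ (Set.mem_insert _ _) ?_
  · by_cases hF : F = D
    · subst hF
      simp [(h.ne_compl F).symm]
    · by_cases hF' : F = c D
      · subst hF'
        simp only [h.compl_compl, Set.mem_insert_iff, Set.mem_sdiff, Set.mem_singleton_iff,
          not_true_eq_false, and_false, or_false, true_or, iff_false]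
        exact fun h1 => h.ne_compl D h1.symm
      · have h1 : c F ≠ c D := fun h1 => hF (h.compl_inj.mp h1)
        have h2 : c F ≠ D := fun h1 => hF' (by rw [← h1, h.compl_compl])
        simp [hF, hF', h1, h2, h.compl_mem_vertex_iff]
  · intro F F' hF hFF'
    by_cases hF' : F' = c D
    · exact Or.inl hF'
    rcases hF with rfl | ⟨hF, hFD⟩
    · refine Or.inr ⟨Or.inr (lt_of_le_of_ne hFF' (Ne.symm hF')), fun h1 => ?_⟩
      rw [Set.mem_singleton_iff] at h1
      exact h.not_compl_le le_rfl (h1 ▸ hFF')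
    · refine Or.inr ⟨(h.isOrientation_vertex D).mem_of_le hF hFF', fun h1 => ?_⟩
      rw [Set.mem_singleton_iff] at h1
      exact hFD (h.eq_of_mem_vertex_of_le hF (h1 ▸ hFF'))
  · rintro F (rfl | ⟨hF, hFD⟩) hle
    · rfl
    · refine absurd ((h.isOrientation_vertex D).mem_of_le (self_mem_vertex D)
        (h.le_compl_comm.mp hle)) ?_
      rw [h.compl_mem_vertex_iff]
      exact not_not.mpr hF

/-- Every half-space containing a vertex contains a half-space ending at that vertex. -/
theorem exists_le_vertex_eq (h : IsTreePocset c out) {D E : P} (hE : E ∈ vertex c D) :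
    ∃ E₀ ≤ E, vertex c E₀ = vertex c D := by
  rcases hE with hE | hE
  · exact ⟨D, hE, rfl⟩
  have hfin : {F | c D < F ∧ F ≤ E}.Finite :=
    (h.finite_Icc (c D) E).subset fun F hF => ⟨hF.1.le, hF.2⟩
  obtain ⟨E₀, hE₀⟩ := hfin.exists_minimal ⟨E, hE, le_rfl⟩
  refine ⟨E₀, hE₀.prop.2, (h.eq_vertex_of_minimal (h.isOrientation_vertex D)
    (Or.inr hE₀.prop.1) fun F hF hFE => ?_).symm⟩
  rcases hF with hF | hF
  · exact absurd hE₀.prop.1.le (h.not_compl_le (hF.trans hFE))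
  · exact hFE.antisymm (hE₀.le_of_le ⟨hF, hFE.trans hE₀.prop.2⟩ hFE)

/-! ### The chain of half-spaces separating a vertex from the root -/

theorem mem_vertex_and_out_iff (h : IsTreePocset c out) {D : P} (hD : out D) {F : P} :
    F ∈ vertex c D ∧ out F ↔ out F ∧ D ≤ F := by
  refine ⟨fun ⟨hF, hF'⟩ => ⟨hF', hF.resolve_right fun h1 => ?_⟩, fun ⟨hF, hF'⟩ => ⟨Or.inl hF', hF⟩⟩
  exact (h.out_compl D).mp (h.out_of_le h1.le hF') hD

theorem finite_vertex_out (h : IsTreePocset c out) (D : P) :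
    {F | F ∈ vertex c D ∧ out F}.Finite := by
  by_cases hD : out D
  · simp only [h.mem_vertex_and_out_iff hD]
    exact h.finite_out D hD
  · refine (h.finite_out (c D) ((h.out_compl D).mpr hD)).subset ?_
    rintro F ⟨hF | hF, hF'⟩
    · exact absurd (h.out_of_le hF hF') hD
    · exact ⟨hF', hF.le⟩

theorem eq_root_of_forall_not_out (h : IsTreePocset c out) {v : Set P} (hv : IsOrientation c v)
    (hout : ∀ F ∈ v, ¬ out F) : v = root out :=
  hv.eq_of_subset h.isOrientation_root hout

theorem mem_vertex_compl_and_out_iff (h : IsTreePocset c out) {D : P} (hD : out D) {F : P} :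
    F ∈ vertex c (c D) ∧ out F ↔ (F ∈ vertex c D ∧ out F) ∧ F ≠ D := by
  rw [h.vertex_compl]
  have : F = c D → ¬ out F := fun h1 => h1 ▸ fun h2 => (h.out_compl D).mp h2 hD
  simp only [Set.mem_insert_iff, Set.mem_sdiff, Set.mem_singleton_iff]
  tauto

/-- Induction along the paths from the root to the vertices. -/
theorem orientation_induction (h : IsTreePocset c out) {motive : Set P → Prop}
    (hroot : motive (root out))
    (step : ∀ D, out D → motive (vertex c (c D)) → motive (vertex c D)) {v : Set P}
    (hv : IsOrientation c v) (hfin : {F | F ∈ v ∧ out F}.Finite) : motive v := by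
  induction hn : {F | F ∈ v ∧ out F}.ncard using Nat.strong_induction_on generalizing v with
  | _ n ih =>
  by_cases hne : {F | F ∈ v ∧ out F}.Nonempty
  · obtain ⟨E, hE⟩ := hfin.exists_minimal hne
    have hvE : v = vertex c E := h.eq_vertex_of_minimal hv hE.prop.1 fun F hF hFE =>
      hFE.antisymm (hE.le_of_le ⟨hF, h.out_of_le hFE hE.prop.2⟩ hFE)
    rw [hvE]
    refine step E hE.prop.2 (ih _ ?_ (h.isOrientation_vertex _) (h.finite_vertex_out _) rfl)
    rw [← hn, hvE]
    refine Set.ncard_lt_ncard ?_ (h.finite_vertex_out _)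
    refine ⟨fun F hF => ((h.mem_vertex_compl_and_out_iff hE.prop.2).mp hF).1, fun h1 => ?_⟩
    exact ((h.mem_vertex_compl_and_out_iff hE.prop.2).mp
      (h1 ⟨self_mem_vertex E, hE.prop.2⟩)).2 rfl
  · rw [h.eq_root_of_forall_not_out hv fun F hF hF' => hne ⟨F, hF, hF'⟩]
    exact hroot

theorem vertex_induction (h : IsTreePocset c out) {motive : Set P → Prop}
    (hroot : motive (root out))
    (step : ∀ D, out D → motive (vertex c (c D)) → motive (vertex c D)) (D : P) :
    motive (vertex c D) :=
  h.orientation_induction hroot step (h.isOrientation_vertex D) (h.finite_vertex_out D)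

theorem exists_vertex_eq_root (h : IsTreePocset c out) [Nonempty P] :
    ∃ D, vertex c D = root out := by
  have hout : ∃ D, out D := by
    obtain ⟨D⟩ := ‹Nonempty P›
    by_cases hD : out D
    · exact ⟨D, hD⟩
    · exact ⟨c D, (h.out_compl D).mpr hD⟩
  obtain ⟨D, hD⟩ := hout
  obtain ⟨E, hE⟩ := (h.finite_out D hD).exists_maximal ⟨D, hD, le_rfl⟩
  refine ⟨c E, h.eq_root_of_forall_not_out (h.isOrientation_vertex _) fun F hF hF' => ?_⟩
  obtain ⟨h1, h2⟩ := (h.mem_vertex_compl_and_out_iff hE.prop.1).mp ⟨hF, hF'⟩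
  rw [h.mem_vertex_and_out_iff hE.prop.1] at h1
  exact h2 ((hE.le_of_ge ⟨hF', hE.prop.2.trans h1.2⟩ h1.2).antisymm h1.2)

/-- A function that is invariant under crossing edges is constant. -/
theorem eq_root_of_vertex_compl (h : IsTreePocset c out) {α : Type*} {f : Set P → α}
    (hf : ∀ D, f (vertex c D) = f (vertex c (c D))) (D : P) :
    f (vertex c D) = f (root out) :=
  h.vertex_induction (motive := fun v => f v = f (root out)) rfl
    (fun D _ hD => (hf D).trans hD) D

theorem exists_chain (h : IsTreePocset c out) : ∃ ch : Set P → List P, ch (root out) = [] ∧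
    ∀ D, out D → ch (vertex c D) = ch (vertex c (c D)) ++ [D] := by
  classical
  have hstep : ∀ D, out D → ∀ l : List P, (∀ F, F ∈ l ↔ F ∈ vertex c (c D) ∧ out F) →
      l.Pairwise (· > ·) →
      (∀ F, F ∈ l ++ [D] ↔ F ∈ vertex c D ∧ out F) ∧ (l ++ [D]).Pairwise (· > ·) := by
    intro D hD l hl hl'
    have hl2 : ∀ F, F ∈ l ↔ (out F ∧ D ≤ F) ∧ F ≠ D := fun F => by
      rw [hl, h.mem_vertex_compl_and_out_iff hD, h.mem_vertex_and_out_iff hD]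
    refine ⟨fun F => ?_, ?_⟩
    · rw [List.mem_append, hl2, h.mem_vertex_and_out_iff hD, List.mem_singleton]
      constructor
      · rintro (h1 | rfl)
        · exact h1.1
        · exact ⟨hD, le_rfl⟩
      · intro h1
        by_cases h2 : F = D
        · exact Or.inr h2
        · exact Or.inl ⟨h1, h2⟩
    · rw [List.pairwise_append]
      refine ⟨hl', List.pairwise_singleton _ _, fun F hF E hE => ?_⟩
      rw [List.mem_singleton] at hE
      subst hE
      obtain ⟨⟨-, h1⟩, h2⟩ := (hl2 F).mp hF
      exact lt_of_le_of_ne h1 (Ne.symm h2)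
  have key : ∀ D, ∃ l : List P, (∀ F, F ∈ l ↔ F ∈ vertex c D ∧ out F) ∧ l.Pairwise (· > ·) := by
    refine h.vertex_induction (motive := fun v => ∃ l : List P,
      (∀ F, F ∈ l ↔ F ∈ v ∧ out F) ∧ l.Pairwise (· > ·)) ?_ ?_
    · exact ⟨[], by simp [root], List.Pairwise.nil⟩
    · rintro D hD ⟨l, hl, hl'⟩
      exact ⟨l ++ [D], hstep D hD l hl hl'⟩
  have huniq : ∀ l l' : List P, (∀ F, F ∈ l ↔ F ∈ l') → l.Pairwise (· > ·) →
      l'.Pairwise (· > ·) → l = l' := by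
    intro l l' hll' hl hl'
    refine List.Perm.eq_of_pairwise (fun a b _ _ h1 h2 => absurd h1 h2.not_gt) hl hl' ?_
    rw [List.perm_ext_iff_of_nodup (hl.imp fun h1 => h1.ne') (hl'.imp fun h1 => h1.ne')]
    exact hll'
  let ch : Set P → List P := fun v =>
    if hv : ∃ l : List P, (∀ F, F ∈ l ↔ F ∈ v ∧ out F) ∧ l.Pairwise (· > ·) then hv.choose else []
  have hch : ∀ v (l : List P), (∀ F, F ∈ l ↔ F ∈ v ∧ out F) → l.Pairwise (· > ·) →
      ch v = l := by
    intro v l hl hl'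
    have hv : ∃ l : List P, (∀ F, F ∈ l ↔ F ∈ v ∧ out F) ∧ l.Pairwise (· > ·) := ⟨l, hl, hl'⟩
    simp only [ch, dif_pos hv]
    exact huniq _ _ (fun F => by rw [hv.choose_spec.1, hl]) hv.choose_spec.2 hl'
  refine ⟨ch, hch _ _ (by simp [root]) List.Pairwise.nil, fun D hD => ?_⟩
  obtain ⟨l, hl, hl'⟩ := key (c D)
  rw [hch _ l hl hl']
  exact hch _ _ (hstep D hD l hl hl').1 (hstep D hD l hl hl').2

end IsTreePocset

namespace IsTreePocset

section Action

variable {P : Type*} [PartialOrder P] {c : P → P} {out : P → Prop} {G : Type*} [Group G]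
  [MulAction G P]

theorem smul_vertex (hle : ∀ (g : G) (D E : P), D ≤ E → g • D ≤ g • E)
    (hc : ∀ (g : G) (D : P), c (g • D) = g • c D) (g : G) (D : P) :
    g • vertex c D = vertex c (g • D) := by
  have hle' : ∀ D E : P, g • D ≤ E ↔ D ≤ g⁻¹ • E := fun D E =>
    ⟨fun h1 => by simpa using hle g⁻¹ _ _ h1, fun h1 => by simpa using hle g _ _ h1⟩
  ext F
  rw [Set.mem_smul_set_iff_inv_smul_mem]
  simp only [vertex, Set.mem_ofPred_eq, hc, lt_iff_le_and_ne, hle', ne_eq, smul_eq_iff_eq_inv_smul]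

/-- A group acting freely and without inversions on a tree is free. -/
theorem isFreeGroup [Nonempty P] (h : IsTreePocset c out)
    (hle : ∀ (g : G) (D E : P), D ≤ E → g • D ≤ g • E)
    (hc : ∀ (g : G) (D : P), c (g • D) = g • c D)
    (hvertex : ∀ (g : G) (D : P), g • vertex c D = vertex c D → g = 1)
    (hinv : ∀ (g : G) (D : P), g • D ≠ c D) : IsFreeGroup G := by
  obtain ⟨ch, hch, hch'⟩ := h.exists_chain
  let q : P → MulAction.orbitRel.Quotient G P := fun D => Quotient.mk _ D
  have hq : ∀ (g : G) D, q (g • D) = q D := fun g D =>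
    Quotient.sound (MulAction.orbitRel_apply.mpr ⟨g, rfl⟩)
  have hq' : ∀ D E, q D = q E → ∃ g : G, g • E = D := fun D E hDE =>
    MulAction.orbitRel_apply.mp (Quotient.exact hDE)
  let w : Set P → List (MulAction.orbitRel.Quotient G P × Bool) := fun v =>
    (ch v).flatMap fun D => [(q D, true), (q (c D), false)]
  have hw : ∀ D, out D → w (vertex c D) =
      w (vertex c (c D)) ++ [(q D, true), (q (c D), false)] := fun D hD => by
    simp [w, hch' D hD]
  let b : P → FreeGroup (MulAction.orbitRel.Quotient G P) := fun D =>
    FreeGroup.of (q D) * (FreeGroup.of (q (c D)))⁻¹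
  let τ : Set P → FreeGroup (MulAction.orbitRel.Quotient G P) := fun v => FreeGroup.mk (w v)
  have hτ₀ : τ (root out) = 1 := by simp [τ, w, hch, FreeGroup.one_eq_mk]
  have hτ_out : ∀ D, out D → τ (vertex c D) = τ (vertex c (c D)) * b D := fun D hD => by
    simp only [τ, hw D hD, b, FreeGroup.of, FreeGroup.inv_mk, FreeGroup.mul_mk]
    rfl
  have hτ : ∀ D, τ (vertex c D) = τ (vertex c (c D)) * b D := by
    intro D
    by_cases hD : out D
    · exact hτ_out D hD
    · have := hτ_out (c D) ((h.out_compl D).mpr hD)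
      rw [this, h.compl_compl]
      simp only [b, h.compl_compl]
      group
  have hb : ∀ (g : G) D, b (g • D) = b D := fun g D => by simp [b, hc, hq]
  have hconst : ∀ (g : G) D, τ (g • vertex c D) = τ (g • root out) * τ (vertex c D) := by
    intro g D
    have := h.eq_root_of_vertex_compl (f := fun v => τ (g • v) * (τ v)⁻¹) (fun D => by
      simp only [smul_vertex hle hc, ← hc]
      rw [hτ (g • D), hτ D, hb, hc]
      group) D
    simp only [hτ₀, inv_one, mul_one] at this
    rw [← this]
    group
  obtain ⟨D₀, hD₀⟩ := h.exists_vertex_eq_root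
  let φ : G →* FreeGroup (MulAction.orbitRel.Quotient G P) := MonoidHom.mk'
    (fun g => τ (g • root out)) fun g g' => by
      rw [mul_smul, ← hD₀, smul_vertex hle hc g', hconst, hD₀, ← hD₀, ← smul_vertex hle hc, hD₀]
  have hred : ∀ D, FreeGroup.IsReduced (w (vertex c D)) := by
    refine h.vertex_induction (motive := fun v => FreeGroup.IsReduced (w v)) ?_ ?_
    · simp [w, hch]
    · intro D hD hr
      have hne : q D ≠ q (c D) := fun h1 => by
        obtain ⟨g, hg⟩ := hq' _ _ h1.symm
        exact hinv g D hg
      rw [hw D hD]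
      refine List.isChain_append.mpr ⟨hr, by simp [hne], ?_⟩
      intro x hx y hy hxy
      have hx' : ∃ D', out D' ∧ vertex c D' = vertex c (c D) ∧ x = (q (c D'), false) := by
        revert hx
        refine h.vertex_induction (out := out) (motive := fun v => x ∈ (w v).getLast? →
          ∃ D', out D' ∧ vertex c D' = v ∧ x = (q (c D'), false)) ?_ ?_ (c D)
        · simp [w, hch]
        · intro D' hD' _ hx
          refine ⟨D', hD', rfl, ?_⟩
          rw [hw D' hD'] at hx
          simpa using hx.symm
      obtain ⟨D', hD', hDD', rfl⟩ := hx'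
      simp only [List.head?_cons, Option.mem_def, Option.some.injEq] at hy
      subst hy
      obtain ⟨g, hg⟩ := hq' _ _ hxy
      have hg' : g • c D = D' := by
        rw [← hc, hg, h.compl_compl]
      have : g = 1 := hvertex g (c D) (by rw [smul_vertex hle hc, hg', hDD'])
      rw [this, one_smul] at hg
      exact absurd hD' ((h.out_compl D').mp (hg ▸ hD))
  have hinj : Function.Injective φ := by
    rw [injective_iff_map_eq_one]
    intro g hg
    have h1 : τ (vertex c (g • D₀)) = 1 := by
      rw [← smul_vertex hle hc, hD₀]
      exact hg
    have h2 : w (vertex c (g • D₀)) = [] := by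
      classical
      have h3 : (τ (vertex c (g • D₀))).toWord = w (vertex c (g • D₀)) := by
        rw [FreeGroup.toWord_mk, (hred _).reduce_eq]
      rw [← h3, h1, FreeGroup.toWord_one]
    have h4 : vertex c (g • D₀) = root out := by
      revert h2
      refine h.vertex_induction (out := out)
        (motive := fun v => w v = [] → v = root out) (fun _ => rfl) ?_ (g • D₀)
      intro D hD _ h5
      rw [hw D hD] at h5
      simp at h5
    exact hvertex g D₀ (by rw [smul_vertex hle hc, h4, hD₀])
  have : IsFreeGroup φ.range := subgroupIsFreeOfIsFree _
  exact IsFreeGroup.ofMulEquiv (MonoidHom.ofInjective hinj).symm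

end Action

end IsTreePocset

section FreeActions

/-- Two free `H`-sets of the same finite cardinality are isomorphic. -/
theorem MulAction.exists_equivariant_equiv {H X Y : Type*} [Group H] [MulAction H X]
    [MulAction H Y] [Finite X] [Finite Y] (hX : ∀ (h : H) (x : X), h • x = x → h = 1)
    (hY : ∀ (h : H) (y : Y), h • y = y → h = 1) (hcard : Nat.card X = Nat.card Y) :
    ∃ f : X → Y, Function.Bijective f ∧ ∀ (h : H) x, f (h • x) = h • f x := by
  rcases isEmpty_or_nonempty X with hemp | ⟨⟨x₀⟩⟩
  · rw [Nat.card_of_isEmpty, eq_comm, Finite.card_eq_zero_iff] at hcard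
    exact ⟨isEmptyElim, ⟨fun x => isEmptyElim x, fun y => isEmptyElim y⟩, fun _ x => isEmptyElim x⟩
  have hHfin : Finite H := Finite.of_injective (fun h : H => h • x₀) fun h h' hh => by
    have := hX (h'⁻¹ * h) x₀ (by rw [mul_smul]; exact inv_smul_eq_iff.mpr hh)
    exact (inv_mul_eq_one.mp this).symm
  have hX' := Nat.card_congr (MulAction.selfEquivOrbitsQuotientProd (G := H) (X := X)
    fun b => (Subgroup.eq_bot_iff_forall _).mpr fun h hh => hX h b hh)
  have hY' := Nat.card_congr (MulAction.selfEquivOrbitsQuotientProd (G := H) (X := Y)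
    fun b => (Subgroup.eq_bot_iff_forall _).mpr fun h hh => hY h b hh)
  rw [Nat.card_prod] at hX' hY'
  have hquot : Nat.card (Quotient (MulAction.orbitRel H X)) =
      Nat.card (Quotient (MulAction.orbitRel H Y)) := by
    refine Nat.eq_of_mul_eq_mul_right (Nat.card_pos (α := H)) ?_
    rw [← hX', ← hY', hcard]
  have hq1 : Finite (Quotient (MulAction.orbitRel H X)) := Quotient.finite _
  have hq2 : Finite (Quotient (MulAction.orbitRel H Y)) := Quotient.finite _
  obtain ⟨σ⟩ := (Finite.card_eq (α := Quotient (MulAction.orbitRel H X))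
    (β := Quotient (MulAction.orbitRel H Y))).mp hquot
  have hrep : ∀ x : X, ∃ h : H, h • (Quotient.mk (MulAction.orbitRel H X) x).out = x := fun x =>
    MulAction.orbitRel_apply.mp
      ((MulAction.orbitRel H X).symm (Quotient.exact (Quotient.out_eq (Quotient.mk _ x))))
  choose s hs using hrep
  let f : X → Y := fun x => s x • (σ (Quotient.mk _ x)).out
  have hsmul : ∀ (h : H) (x : X),
      Quotient.mk (MulAction.orbitRel H X) (h • x) = Quotient.mk _ x := fun h x =>
    Quotient.sound (MulAction.orbitRel_apply.mpr ⟨h, rfl⟩)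
  have hequiv : ∀ (h : H) x, f (h • x) = h • f x := by
    intro h x
    have h1 := hs (h • x)
    rw [hsmul] at h1
    have h2 := hX ((h * s x)⁻¹ * s (h • x)) (Quotient.mk (MulAction.orbitRel H X) x).out (by
      rw [mul_smul, h1, inv_smul_eq_iff, mul_smul, hs])
    rw [inv_mul_eq_one] at h2
    simp only [f, hsmul, ← h2, mul_smul]
  have hfmk : ∀ x, Quotient.mk (MulAction.orbitRel H Y) (f x) = σ (Quotient.mk _ x) := by
    intro x
    conv_rhs => rw [← Quotient.out_eq (σ (Quotient.mk _ x))]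
    exact Quotient.sound (MulAction.orbitRel_apply.mpr ⟨_, rfl⟩)
  have hinj : Function.Injective f := by
    intro x x' hxx
    have h1 : Quotient.mk (MulAction.orbitRel H X) x = Quotient.mk _ x' :=
      σ.injective (by rw [← hfmk, ← hfmk, hxx])
    obtain ⟨h, rfl⟩ := MulAction.orbitRel_apply.mp (Quotient.exact h1)
    dsimp only at hxx ⊢
    rw [hequiv] at hxx
    rw [hY h _ hxx, one_smul]
  exact ⟨f, (Nat.bijective_iff_injective_and_card f).mpr ⟨hinj, hcard⟩, hequiv⟩

variable {G : Type*} [Group G]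

/-- If two pullbacks of a free bundle have finite fibres of the same size, they are isomorphic. -/
theorem MulAction.exists_equivariant_bijOn {E P X : Type*} [MulAction G E] [MulAction G P]
    [MulAction G X] (hfree : ∀ (g : G) (e : E), g • e = e → g = 1) {π : E → X}
    (hπ : ∀ (g : G) e, π (g • e) = g • π e) {α β : P → X} (hα : ∀ (g : G) D, α (g • D) = g • α D)
    (hβ : ∀ (g : G) D, β (g • D) = g • β D) (hαfin : ∀ D, (π ⁻¹' {α D}).Finite)
    (hβfin : ∀ D, (π ⁻¹' {β D}).Finite)
    (hcard : ∀ D, (π ⁻¹' {α D}).ncard = (π ⁻¹' {β D}).ncard) :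
    ∃ j : P → E → E, (∀ D, Set.BijOn (j D) (π ⁻¹' {α D}) (π ⁻¹' {β D})) ∧
      ∀ (g : G) D e, π e = α D → j (g • D) (g • e) = g • j D e := by
  classical
  have hloc : ∀ D : P, ∃ f : E → E, Set.BijOn f (π ⁻¹' {α D}) (π ⁻¹' {β D}) ∧
      ∀ h : G, h • D = D → ∀ e, π e = α D → f (h • e) = h • f e := by
    intro D
    let actOn : ∀ γ : P → X, (∀ (g : G) D, γ (g • D) = g • γ D) →
        MulAction (MulAction.stabilizer G D) (π ⁻¹' {γ D}) := fun γ hγ =>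
      { smul := fun h e => ⟨(h : G) • (e : E), by
          have h1 : (h : G) • D = D := h.2
          have h2 : π e = γ D := e.2
          rw [Set.mem_preimage, Set.mem_singleton_iff, hπ, h2, ← hγ, h1]⟩
        one_smul := fun e => Subtype.ext (one_smul G (e : E))
        mul_smul := fun h h' e => Subtype.ext (mul_smul (h : G) (h' : G) (e : E)) }
    let := actOn α hα
    let := actOn β hβ
    have : Finite (π ⁻¹' {α D}) := (hαfin D).to_subtype
    have : Finite (π ⁻¹' {β D}) := (hβfin D).to_subtype
    obtain ⟨f, hf, hf'⟩ := MulAction.exists_equivariant_equiv (H := MulAction.stabilizer G D)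
      (X := (π ⁻¹' {α D} : Set E)) (Y := (π ⁻¹' {β D} : Set E))
      (fun h e he => Subtype.ext (hfree _ _ (congrArg Subtype.val he)))
      (fun h e he => Subtype.ext (hfree _ _ (congrArg Subtype.val he)))
      (by simpa [Nat.card_coe_set_eq] using hcard D)
    let F : E → E := fun e => if he : π e = α D then f ⟨e, he⟩ else e
    have hF : ∀ e (he : π e = α D), F e = f ⟨e, he⟩ := fun e he => dif_pos he
    refine ⟨F, ⟨fun e he => ?_, fun e he e' he' hee => ?_, fun e he => ?_⟩, fun h hh e he => ?_⟩
    · rw [hF e he]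
      exact (f ⟨e, he⟩).2
    · rw [hF e he, hF e' he'] at hee
      exact congrArg Subtype.val (hf.1 (Subtype.ext hee))
    · obtain ⟨e', he'⟩ := hf.2 ⟨e, he⟩
      exact ⟨e', e'.2, by rw [hF e' e'.2, he']⟩
    · have he' : π (h • e) = α D := by rw [hπ, he, ← hα, hh]
      rw [hF e he, hF _ he']
      exact congrArg Subtype.val (hf' ⟨h, hh⟩ ⟨e, he⟩)
  choose f hf hf' using hloc
  let r : P → P := fun D => (Quotient.mk (MulAction.orbitRel G P) D).out
  have hr : ∀ (g : G) D, r (g • D) = r D := fun g D =>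
    congrArg Quotient.out (Quotient.sound (MulAction.orbitRel_apply.mpr ⟨g, rfl⟩))
  have hrep : ∀ D : P, ∃ g : G, g • r D = D := fun D =>
    MulAction.orbitRel_apply.mp
      ((MulAction.orbitRel G P).symm (Quotient.exact (Quotient.out_eq (Quotient.mk _ D))))
  choose s hs using hrep
  have hfib : ∀ (γ : P → X), (∀ (g : G) D, γ (g • D) = g • γ D) → ∀ D e,
      π e = γ D ↔ π ((s D)⁻¹ • e) = γ (r D) := by
    intro γ hγ D e
    rw [hπ, inv_smul_eq_iff, ← hγ, hs]
  refine ⟨fun D e => s D • f (r D) ((s D)⁻¹ • e), fun D => ⟨fun e he => ?_,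
    fun e he e' he' hee => ?_,
    fun e he => ?_⟩, fun g D e he => ?_⟩
  · have := (hf (r D)).mapsTo ((hfib α hα D e).mp he)
    rw [Set.mem_preimage, Set.mem_singleton_iff, hfib β hβ, inv_smul_smul]
    exact this
  · have := (hf (r D)).injOn ((hfib α hα D e).mp he) ((hfib α hα D e').mp he')
      (smul_left_cancel _ hee)
    exact smul_left_cancel _ this
  · obtain ⟨e', he', hee⟩ := (hf (r D)).surjOn ((hfib β hβ D e).mp he)
    refine ⟨s D • e', ?_, ?_⟩
    · rw [Set.mem_preimage, Set.mem_singleton_iff, hfib α hα, inv_smul_smul]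
      exact he'
    · dsimp only
      rw [inv_smul_smul, hee, smul_inv_smul]
  · have h1 := hs (g • D)
    rw [hr] at h1
    have h2 : ((s (g • D))⁻¹ * g * s D) • r D = r D := by
      rw [mul_smul, mul_smul, hs, inv_smul_eq_iff, h1]
    have h3 := hf' (r D) _ h2 ((s D)⁻¹ • e) ((hfib α hα D e).mp he)
    have h4 : ((s (g • D))⁻¹ * g * s D) • (s D)⁻¹ • e = (s (g • D))⁻¹ • g • e := by
      simp only [smul_smul]
      congr 1
      group
    rw [h4] at h3
    dsimp only
    rw [hr, h3]
    simp only [smul_smul]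
    congr 1
    group

/-- A `G`-set is covered by a free `G`-set whose fibres over the points with small finite
stabiliser have a prescribed cardinality. -/
theorem MulAction.exists_free_bundle.{u, v} {G : Type u} {X : Type v} [Group G] [MulAction G X]
    (N : ℕ) :
    ∃ (E : Type (max u v)) (_ : MulAction G E) (π : E → X),
      (∀ (g : G) (e : E), g • e = e → g = 1) ∧ (∀ (g : G) e, π (g • e) = g • π e) ∧
      ∀ x, Nat.card (MulAction.stabilizer G x) ∣ N → (π ⁻¹' {x}).ncard = N := by
  let J := Σ o : MulAction.orbitRel.Quotient G X,
    Fin (N / Nat.card (MulAction.stabilizer G (Quotient.out o)))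
  let act : MulAction G (G × J) :=
    { smul := fun g e => (g * e.1, e.2)
      one_smul := fun e => Prod.ext (one_mul _) rfl
      mul_smul := fun g g' e => Prod.ext (mul_assoc _ _ _) rfl }
  have hact : ∀ (g : G) (e : G × J), g • e = (g * e.1, e.2) := fun _ _ => rfl
  refine ⟨G × J, act, fun e => e.1 • Quotient.out e.2.1, ?_, ?_, ?_⟩
  · intro g e he
    exact mul_eq_right.mp (congrArg Prod.fst he)
  · intro g e
    simp only [hact, mul_smul]
  · intro x hx
    let o : MulAction.orbitRel.Quotient G X := Quotient.mk _ x
    obtain ⟨t, ht⟩ : ∃ t : G, t • Quotient.out o = x := MulAction.orbitRel_apply.mp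
      ((MulAction.orbitRel G X).symm (Quotient.exact (Quotient.out_eq (Quotient.mk _ x))))
    have hcard : Nat.card (MulAction.stabilizer G (Quotient.out o)) =
        Nat.card (MulAction.stabilizer G x) :=
      Nat.card_congr (MulAction.stabilizerEquivStabilizer (g := t) ht.symm).toEquiv
    let F : MulAction.stabilizer G (Quotient.out o) ×
        Fin (N / Nat.card (MulAction.stabilizer G (Quotient.out o))) → G × J :=
      fun p => (t * p.1, ⟨o, p.2⟩)
    have hF : Function.Injective F := by
      rintro ⟨p, i⟩ ⟨p', i'⟩ hpp
      simp only [F, Prod.mk.injEq, mul_right_inj, SetLike.coe_eq_coe] at hpp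
      obtain ⟨h1, h2⟩ := hpp
      rw [h1, eq_of_heq (Sigma.mk.inj h2).2]
    have hrange : Set.range F =
        (fun e : G × J => e.1 • Quotient.out e.2.1) ⁻¹' {x} := by
      ext ⟨g, o', i⟩
      simp only [Set.mem_range, Set.mem_preimage, Set.mem_singleton_iff]
      constructor
      · rintro ⟨⟨p, i'⟩, hp⟩
        simp only [F, Prod.mk.injEq] at hp
        obtain ⟨rfl, h2⟩ := hp
        have h3 : o = o' := congrArg Sigma.fst h2
        rw [← h3, mul_smul, show (p : G) • Quotient.out o = Quotient.out o from p.2, ht]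
      · intro hg
        have h1 : o = o' := by
          rw [← Quotient.out_eq o']
          exact Quotient.sound (MulAction.orbitRel_apply.mpr ⟨g, hg⟩)
        subst h1
        refine ⟨(⟨t⁻¹ * g, ?_⟩, i), ?_⟩
        · rw [MulAction.mem_stabilizer_iff, mul_smul, hg, inv_smul_eq_iff, ht]
        · simp [F]
    rw [← hrange, ← Nat.card_coe_set_eq, Nat.card_range_of_injective hF, Nat.card_prod,
      Nat.card_fin, hcard, Nat.mul_div_cancel' hx]

end FreeActions

namespace IsTreePocset

variable {P : Type*} [PartialOrder P] {c : P → P} {out : P → Prop} {G : Type*} [Group G]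
  [MulAction G P]

theorem exists_section {E : Type*} [Nonempty P] (h : IsTreePocset c out) {π : E → Set P}
    {j : P → E → E} (hj : ∀ D, Set.BijOn (j D) (π ⁻¹' {vertex c D}) (π ⁻¹' {{D, c D}}))
    (hne : ∀ D, (π ⁻¹' {vertex c D}).Nonempty) :
    ∃ s : Set P → E, ∀ D, π (s (vertex c D)) = vertex c D ∧
      j D (s (vertex c D)) = j (c D) (s (vertex c (c D))) := by
  obtain ⟨D₀, hD₀⟩ := h.exists_vertex_eq_root
  obtain ⟨e₀, he₀⟩ := hne D₀
  have hjc : ∀ D, Set.BijOn (j (c D)) (π ⁻¹' {vertex c (c D)}) (π ⁻¹' {{D, c D}}) := by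
    intro D
    have := hj (c D)
    rwa [h.compl_compl, Set.pair_comm] at this
  have htrans : ∀ D e, ∃ e', π e = vertex c (c D) → π e' = vertex c D ∧ j D e' = j (c D) e := by
    intro D e
    by_cases he : π e = vertex c (c D)
    · obtain ⟨e', he', hee⟩ := (hj D).surjOn ((hjc D).mapsTo he)
      exact ⟨e', fun _ => ⟨he', hee⟩⟩
    · exact ⟨e, fun h1 => absurd h1 he⟩
  choose T hT using htrans
  obtain ⟨ch, hch, hch'⟩ := h.exists_chain
  let s : Set P → E := fun v => (ch v).foldl (fun e D => T D e) e₀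
  have hs : ∀ D, out D → s (vertex c D) = T D (s (vertex c (c D))) := fun D hD => by
    simp [s, hch' D hD]
  have hπ : ∀ D, π (s (vertex c D)) = vertex c D := by
    refine h.vertex_induction (motive := fun v => π (s v) = v) ?_ ?_
    · rw [← hD₀]
      simp only [s, hD₀, hch, List.foldl_nil]
      rw [← hD₀]
      exact he₀
    · intro D hD ih
      rw [hs D hD]
      exact (hT D _ ih).1
  have hout : ∀ D, out D → j D (s (vertex c D)) = j (c D) (s (vertex c (c D))) := fun D hD => by
    rw [hs D hD]
    exact (hT D _ (hπ _)).2
  refine ⟨s, fun D => ⟨hπ D, ?_⟩⟩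
  by_cases hD : out D
  · exact hout D hD
  · have := hout (c D) ((h.out_compl D).mpr hD)
    rw [h.compl_compl] at this
    exact this.symm

theorem smul_pair {Q : Type*} [MulAction G Q] {c : Q → Q}
    (hc : ∀ (g : G) (D : Q), c (g • D) = g • c D) (g : G) (D : Q) :
    ({g • D, c (g • D)} : Set Q) = g • ({D, c D} : Set Q) := by
  rw [hc, Set.smul_set_insert, Set.smul_set_singleton]

/-- A group acting on a tree with finite stabilisers of bounded order has a finite-index subgroup
acting freely and without inversions. -/
theorem exists_finiteIndex_free [Nonempty P] (h : IsTreePocset c out)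
    (hle : ∀ (g : G) (D E : P), D ≤ E → g • D ≤ g • E)
    (hc : ∀ (g : G) (D : P), c (g • D) = g • c D) {N : ℕ} (hN : N ≠ 0)
    (hvertex : ∀ D, Nat.card (MulAction.stabilizer G (vertex c D)) ∣ N)
    (hedge : ∀ D, Nat.card (MulAction.stabilizer G ({D, c D} : Set P)) ∣ N) :
    ∃ K : Subgroup G, K.FiniteIndex ∧
      (∀ k ∈ K, ∀ D, k • vertex c D = vertex c D → k = 1) ∧ ∀ k ∈ K, ∀ D : P, k • D ≠ c D := by
  obtain ⟨E, actE, π, hfree, hπ, hfib⟩ := MulAction.exists_free_bundle (G := G) (X := Set P) N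
  have hV := fun D => hfib _ (hvertex D)
  have hE := fun D => hfib _ (hedge D)
  have hVfin : ∀ D, (π ⁻¹' {vertex c D}).Finite := fun D =>
    Set.finite_of_ncard_ne_zero (by rwa [hV D])
  obtain ⟨j, hj, hj'⟩ := MulAction.exists_equivariant_bijOn (G := G) hfree hπ
    (α := fun D => vertex c D) (β := fun D => ({D, c D} : Set P))
    (fun g D => (smul_vertex hle hc g D).symm) (smul_pair hc) hVfin
    (fun D => Set.finite_of_ncard_ne_zero (by rwa [hE D])) (fun D => by rw [hV, hE])
  obtain ⟨s₀, hs₀⟩ := h.exists_section hj fun D => Set.nonempty_of_ncard_ne_zero (by rwa [hV D])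
  let S : Set (P → E) := {s | (∀ D, π (s D) = vertex c D) ∧
    (∀ D D', vertex c D = vertex c D' → s D = s D') ∧ ∀ D, j D (s D) = j (c D) (s (c D))}
  have hS₀ : (fun D => s₀ (vertex c D)) ∈ S :=
    ⟨fun D => (hs₀ D).1, fun D D' hDD => congrArg s₀ hDD, fun D => (hs₀ D).2⟩
  have hmem : ∀ (g : G) s, s ∈ S → (fun D => g • s (g⁻¹ • D)) ∈ S := by
    rintro g s ⟨h1, h2, h3⟩
    refine ⟨fun D => ?_, fun D D' hDD => ?_, fun D => ?_⟩
    · rw [hπ, h1, smul_vertex hle hc, smul_inv_smul]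
    · refine congrArg (g • ·) (h2 _ _ ?_)
      rw [← smul_vertex hle hc, ← smul_vertex hle hc, hDD]
    · have h4 := hj' g (g⁻¹ • D) _ (h1 _)
      have h5 := hj' g (c (g⁻¹ • D)) _ (h1 _)
      rw [h3, ← h5, smul_inv_smul, hc, smul_inv_smul] at h4
      exact h4
  let actS : MulAction G S :=
    { smul := fun g s => ⟨_, hmem g s s.2⟩
      one_smul := fun s => Subtype.ext (funext fun D => by
        change (1 : G) • s.1 ((1 : G)⁻¹ • D) = s.1 D
        simp)
      mul_smul := fun g g' s => Subtype.ext (funext fun D => by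
        change (g * g') • s.1 ((g * g')⁻¹ • D) = g • g' • s.1 (g'⁻¹ • g⁻¹ • D)
        simp [mul_smul]) }
  have hSfin : Finite S := by
    obtain ⟨D₀⟩ := ‹Nonempty P›
    have := (hVfin D₀).to_subtype
    refine Finite.of_injective (fun s : S => (⟨s.1 D₀, s.2.1 D₀⟩ : π ⁻¹' {vertex c D₀})) ?_
    rintro ⟨s, hs1, hs2, hs3⟩ ⟨s', hs1', hs2', hs3'⟩ hss
    have hss' : s D₀ = s' D₀ := congrArg Subtype.val hss
    have hiff : ∀ D, (∀ D', vertex c D' = vertex c D → s D' = s' D') ↔ s D = s' D := fun D =>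
      ⟨fun h1 => h1 D rfl, fun h1 D' hD' => by rw [hs2 _ _ hD', hs2' _ _ hD', h1]⟩
    have hstep : ∀ D, s (c D) = s' (c D) → s D = s' D := fun D hD =>
      (hj D).injOn (hs1 D) (hs1' D) (by rw [hs3, hs3', hD])
    have hconst := h.eq_root_of_vertex_compl (out := out)
      (f := fun v => ∀ D', vertex c D' = v → s D' = s' D') fun D => by
        rw [hiff, hiff, eq_iff_iff]
        refine ⟨fun hD => hstep _ ?_, hstep D⟩
        rwa [h.compl_compl]
    refine Subtype.ext (funext fun D => ?_)
    rw [← hiff, hconst D, ← hconst D₀, hiff]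
    exact hss'
  refine ⟨(MulAction.toPermHom G S).ker, Subgroup.finiteIndex_ker _, ?_⟩
  have hfix : ∀ k ∈ (MulAction.toPermHom G S).ker, ∀ D,
      k • s₀ (vertex c (k⁻¹ • D)) = s₀ (vertex c D) := by
    intro k hk D
    have h1 := congrFun (congrArg DFunLike.coe (MonoidHom.mem_ker.mp hk)) (⟨_, hS₀⟩ : S)
    exact congrFun (congrArg Subtype.val h1) D
  have hone : ∀ k ∈ (MulAction.toPermHom G S).ker, ∀ D,
      k • vertex c D = vertex c D → k = 1 := by
    intro k hk D hD
    refine hfree k (s₀ (vertex c D)) ?_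
    have h1 := hfix k hk D
    rwa [← smul_vertex hle hc, inv_smul_eq_iff.mpr hD.symm] at h1
  refine ⟨hone, fun k hk D hD => ?_⟩
  have h1 : k = 1 := by
    refine hfree k (j D (s₀ (vertex c D))) ?_
    have h2 := hfix k hk (k • D)
    rw [inv_smul_smul, hD] at h2
    rw [← hj' k D _ (hs₀ D).1, hD, h2, (hs₀ D).2]
  rw [h1, one_smul] at hD
  exact h.ne_compl D hD.symm

/-- A group acting on a tree with finite stabilisers of bounded order is virtually free. -/
theorem virtuallyFree [Nonempty P] (h : IsTreePocset c out)
    (hle : ∀ (g : G) (D E : P), D ≤ E → g • D ≤ g • E)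
    (hc : ∀ (g : G) (D : P), c (g • D) = g • c D) {N : ℕ} (hN : N ≠ 0)
    (hvertex : ∀ D, Nat.card (MulAction.stabilizer G (vertex c D)) ∣ N)
    (hedge : ∀ D, Nat.card (MulAction.stabilizer G ({D, c D} : Set P)) ∣ N) :
    VirtuallyFree G := by
  obtain ⟨K, hK, h1, h2⟩ := h.exists_finiteIndex_free hle hc hN hvertex hedge
  refine ⟨K, hK, h.isFreeGroup (fun k D E hDE => hle k D E hDE) (fun k D => hc k D)
    (fun k D hD => Subtype.ext (h1 k k.2 D hD)) fun k D => h2 k k.2 D⟩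

end IsTreePocset

section Cuts

variable {G : Type*} [Group G] {A : Set G}

/-- The edge boundary of a set of vertices of the Cayley graph, oriented outwards. -/
def cutBoundary (A C : Set G) : Set (G × G) := {p | p.1 ∈ C ∧ p.2 ∉ C ∧ CayleyAdj A p.1 p.2}

theorem cutBoundary_compl (C : Set G) : cutBoundary A Cᶜ = Prod.swap '' cutBoundary A C := by
  ext ⟨x, y⟩
  simp only [cutBoundary, Set.image_swap_eq_preimage_swap, Set.mem_preimage, Set.mem_ofPred_eq,
    Set.mem_compl_iff, Prod.fst_swap, Prod.snd_swap, not_not, cayleyAdj_comm (x := x)]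
  tauto

theorem cutBoundary_smul (g : G) (C : Set G) :
    cutBoundary A (g • C) = (fun p => (g * p.1, g * p.2)) '' cutBoundary A C := by
  ext ⟨x, y⟩
  simp only [cutBoundary, Set.mem_image, Set.mem_ofPred_eq, Set.mem_smul_set_iff_inv_smul_mem,
    smul_eq_mul, Prod.mk.injEq, Prod.exists]
  constructor
  · rintro ⟨h1, h2, h3⟩
    exact ⟨g⁻¹ * x, g⁻¹ * y, ⟨h1, h2, (cayleyAdj_mul_left _ _ _).mpr h3⟩, by simp, by simp⟩
  · rintro ⟨a, b, ⟨h1, h2, h3⟩, rfl, rfl⟩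
    exact ⟨by simpa using h1, by simpa using h2, (cayleyAdj_mul_left _ _ _).mpr h3⟩

theorem ncard_cutBoundary_compl (C : Set G) :
    (cutBoundary A Cᶜ).ncard = (cutBoundary A C).ncard := by
  rw [cutBoundary_compl, Set.ncard_image_of_injective _ Prod.swap_injective]

theorem finite_cutBoundary_compl {C : Set G} (hC : (cutBoundary A C).Finite) :
    (cutBoundary A Cᶜ).Finite := by
  rw [cutBoundary_compl]
  exact hC.image _

theorem mul_left_prod_injective (g : G) :
    Function.Injective (fun p : G × G => (g * p.1, g * p.2)) := by
  rintro ⟨a, b⟩ ⟨a', b'⟩ h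
  simpa using h

theorem ncard_cutBoundary_smul (g : G) (C : Set G) :
    (cutBoundary A (g • C)).ncard = (cutBoundary A C).ncard := by
  rw [cutBoundary_smul, Set.ncard_image_of_injective _ (mul_left_prod_injective g)]

theorem finite_cutBoundary_smul (g : G) {C : Set G} (hC : (cutBoundary A C).Finite) :
    (cutBoundary A (g • C)).Finite := by
  rw [cutBoundary_smul]
  exact hC.image _

theorem ncard_add_ncard_le_of_subset {α : Type*} {s t s' t' : Set α} (hs' : s'.Finite)
    (ht' : t'.Finite) (hunion : s ∪ t ⊆ s' ∪ t') (hinter : s ∩ t ⊆ s' ∩ t') :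
    s.ncard + t.ncard ≤ s'.ncard + t'.ncard := by
  have hfin := (hs'.union ht').subset hunion
  rw [← Set.ncard_union_add_ncard_inter s t (hfin.subset Set.subset_union_left)
    (hfin.subset Set.subset_union_right), ← Set.ncard_union_add_ncard_inter s' t' hs' ht']
  exact Nat.add_le_add (Set.ncard_le_ncard hunion (hs'.union ht'))
    (Set.ncard_le_ncard hinter (hs'.inter_of_left _))

theorem ncard_add_ncard_lt_of_subset {α : Type*} {s t s' t' : Set α} (hs' : s'.Finite)
    (ht' : t'.Finite) (hunion : s ∪ t ⊂ s' ∪ t') (hinter : s ∩ t ⊆ s' ∩ t') :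
    s.ncard + t.ncard < s'.ncard + t'.ncard := by
  have hfin := (hs'.union ht').subset hunion.subset
  rw [← Set.ncard_union_add_ncard_inter s t (hfin.subset Set.subset_union_left)
    (hfin.subset Set.subset_union_right), ← Set.ncard_union_add_ncard_inter s' t' hs' ht']
  exact Nat.add_lt_add_of_lt_of_le (Set.ncard_lt_ncard hunion (hs'.union ht'))
    (Set.ncard_le_ncard hinter (hs'.inter_of_left _))

theorem cutBoundary_inter_subset (C D : Set G) :
    cutBoundary A (C ∩ D) ⊆ cutBoundary A C ∪ cutBoundary A D := by
  rintro p ⟨⟨h1, h2⟩, h3, h4⟩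
  by_cases h5 : p.2 ∈ C
  · exact Or.inr ⟨h2, fun h6 => h3 ⟨h5, h6⟩, h4⟩
  · exact Or.inl ⟨h1, h5, h4⟩

theorem ncard_cutBoundary_inter_add_le {C D : Set G} (hC : (cutBoundary A C).Finite)
    (hD : (cutBoundary A D).Finite) :
    (cutBoundary A (C ∩ D)).ncard + (cutBoundary A (Cᶜ ∩ Dᶜ)).ncard ≤
      (cutBoundary A C).ncard + (cutBoundary A D).ncard := by
  rw [← Set.compl_union, ncard_cutBoundary_compl]
  refine ncard_add_ncard_le_of_subset hC hD ?_ ?_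
  · rintro p (hp | hp)
    · exact cutBoundary_inter_subset C D hp
    · obtain ⟨h1 | h1, h2, h3⟩ := hp
      · exact Or.inl ⟨h1, fun h4 => h2 (Or.inl h4), h3⟩
      · exact Or.inr ⟨h1, fun h4 => h2 (Or.inr h4), h3⟩
  · rintro p ⟨⟨⟨h1, h2⟩, -, h3⟩, -, h4, -⟩
    exact ⟨⟨h1, fun h5 => h4 (Or.inl h5), h3⟩, h2, fun h5 => h4 (Or.inr h5), h3⟩

theorem exists_mem_of_reflTransGen {α : Type*} {r : α → α → Prop} {C : Set α} {x y : α}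
    (h : Relation.ReflTransGen r x y) (hx : x ∈ C) (hy : y ∉ C) :
    ∃ a b, r a b ∧ a ∈ C ∧ b ∉ C := by
  by_contra! hcon
  induction h with
  | refl => exact hy hx
  | @tail b d _ hbc ih =>
    by_cases hb : b ∈ C
    · exact hy (hcon _ _ hbc hb)
    · exact ih hb

/-- A geodesic from a point of `C` to a point outside `C` crosses the boundary of `C`. -/
theorem exists_cutBoundary_between (hgen : Subgroup.closure A = ⊤) {C : Set G} {x y : G}
    (hx : x ∈ C) (hy : y ∉ C) : ∃ p ∈ cutBoundary A C,
      wordDist A x p.1 + wordDist A p.1 y = wordDist A x y ∧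
      wordDist A x p.2 + wordDist A p.2 y = wordDist A x y := by
  obtain ⟨a, b, ⟨h1, h2, h3⟩, ha, hb⟩ :=
    exists_mem_of_reflTransGen (reflTransGen_between hgen x y) hx hy
  exact ⟨(a, b), ⟨ha, hb, h1⟩, h2, h3⟩

theorem eq_univ_of_cutBoundary_eq_empty (hgen : Subgroup.closure A = ⊤) {C : Set G} {x : G}
    (hx : x ∈ C) (h : cutBoundary A C = ∅) : C = Set.univ := by
  by_contra! hne
  obtain ⟨y, hy⟩ := (Set.ne_univ_iff_exists_notMem C).mp hne
  obtain ⟨p, hp, -⟩ := exists_cutBoundary_between hgen hx hy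
  rw [h] at hp
  exact hp

theorem eq_of_cutBoundary_eq (hgen : Subgroup.closure A = ⊤) {C D : Set G}
    (h : cutBoundary A C = cutBoundary A D) (hne : (cutBoundary A C).Nonempty) : C = D := by
  obtain ⟨p, hp⟩ := hne
  have hpD := h ▸ hp
  have key : {y | y ∈ C ↔ y ∈ D} = Set.univ := by
    refine eq_univ_of_cutBoundary_eq_empty hgen (x := p.1) (by simp [hp.1, hpD.1]) ?_
    refine Set.eq_empty_of_forall_notMem fun q hq => ?_
    obtain ⟨h1, h2, h3⟩ := hq
    simp only [Set.mem_ofPred_eq] at h1 h2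
    have e1 : q ∈ cutBoundary A C ↔ q ∈ cutBoundary A D := by rw [h]
    have e2 : q.swap ∈ cutBoundary A C ↔ q.swap ∈ cutBoundary A D := by rw [h]
    simp only [cutBoundary, Set.mem_ofPred_eq, Prod.fst_swap, Prod.snd_swap, h3, h3.symm,
      and_true] at e1 e2
    tauto
  exact Set.ext fun y => Set.eq_univ_iff_forall.mp key y

/-- `C` is a minimal cut separating the ultrafilters `u` and `v`, of capacity at most `K`. -/
structure IsMinCut (A : Set G) (K : ℕ) (u v : Ultrafilter G) (C : Set G) : Prop where
  mem : C ∈ u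
  notMem : C ∉ v
  finite : (cutBoundary A C).Finite
  ncard_le : (cutBoundary A C).ncard ≤ K
  le_ncard : ∀ C', C' ∈ u → C' ∉ v → (cutBoundary A C').Finite →
    (cutBoundary A C).ncard ≤ (cutBoundary A C').ncard

namespace IsMinCut

variable {K : ℕ} {u v : Ultrafilter G} {C : Set G}

theorem compl (h : IsMinCut A K u v C) : IsMinCut A K v u Cᶜ where
  mem := Ultrafilter.compl_mem_iff_notMem.mpr h.notMem
  notMem := Ultrafilter.compl_notMem_iff.mpr h.mem
  finite := finite_cutBoundary_compl h.finite
  ncard_le := by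
    rw [ncard_cutBoundary_compl]
    exact h.ncard_le
  le_ncard C' h1 h2 h3 := by
    rw [ncard_cutBoundary_compl, ← ncard_cutBoundary_compl C']
    exact h.le_ncard _ (Ultrafilter.compl_mem_iff_notMem.mpr h2)
      (Ultrafilter.compl_notMem_iff.mpr h1) (finite_cutBoundary_compl h3)

theorem mem_map_mul_left (g : G) (C : Set G) (u : Ultrafilter G) :
    C ∈ u.map (g * ·) ↔ g⁻¹ • C ∈ u := by
  rw [Ultrafilter.mem_map]
  exact iff_of_eq (congrArg (· ∈ u) (Set.preimage_smul g C))

theorem smul (h : IsMinCut A K u v C) (g : G) :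
    IsMinCut A K (u.map (g * ·)) (v.map (g * ·)) (g • C) where
  mem := by
    rw [mem_map_mul_left, inv_smul_smul]
    exact h.mem
  notMem := by
    rw [mem_map_mul_left, inv_smul_smul]
    exact h.notMem
  finite := finite_cutBoundary_smul g h.finite
  ncard_le := by
    rw [ncard_cutBoundary_smul]
    exact h.ncard_le
  le_ncard C' h1 h2 h3 := by
    rw [mem_map_mul_left] at h1 h2
    rw [ncard_cutBoundary_smul, ← ncard_cutBoundary_smul g⁻¹ C']
    exact h.le_ncard _ h1 h2 (finite_cutBoundary_smul _ h3)

theorem nonempty (h : IsMinCut A K u v C) : C.Nonempty := u.nonempty_of_mem h.mem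

theorem ne_univ (h : IsMinCut A K u v C) : C ≠ Set.univ := fun h1 =>
  h.notMem (h1 ▸ Filter.univ_mem)

theorem nonempty_cutBoundary (hgen : Subgroup.closure A = ⊤) (h : IsMinCut A K u v C) :
    (cutBoundary A C).Nonempty := by
  obtain ⟨x, hx⟩ := h.nonempty
  rw [Set.nonempty_iff_ne_empty]
  exact fun h1 => h.ne_univ (eq_univ_of_cutBoundary_eq_empty hgen hx h1)

/-- Minimal cuts are connected. -/
theorem connected (hgen : Subgroup.closure A = ⊤) (h : IsMinCut A K u v C) {x y : G}
    (hx : x ∈ C) (hy : y ∈ C) :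
    Relation.ReflTransGen (fun a b => CayleyAdj A a b ∧ b ∈ C) x y := by
  let C₁ : Set G := {z | Relation.ReflTransGen (fun a b => CayleyAdj A a b ∧ b ∈ C) x z}
  have hsub : C₁ ⊆ C := fun z hz => (reflTransGen_and_mem hz hx).2
  have hstep : ∀ {a b}, CayleyAdj A a b → a ∈ C₁ → b ∈ C → b ∈ C₁ := fun hab ha hb =>
    Relation.ReflTransGen.tail ha ⟨hab, hb⟩
  have hbd : cutBoundary A C = cutBoundary A C₁ ∪ cutBoundary A (C \ C₁) := by
    ext p
    constructor
    · rintro ⟨h1, h2, h3⟩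
      by_cases h4 : p.1 ∈ C₁
      · exact Or.inl ⟨h4, fun h5 => h2 (hsub h5), h3⟩
      · exact Or.inr ⟨⟨h1, h4⟩, fun h5 => h2 h5.1, h3⟩
    · rintro (⟨h1, h2, h3⟩ | ⟨h1, h2, h3⟩)
      · exact ⟨hsub h1, fun h4 => h2 (hstep h3 h1 h4), h3⟩
      · exact ⟨h1.1, fun h4 => h2 ⟨h4, fun h5 => h1.2 (hstep h3.symm h5 h1.1)⟩, h3⟩
  have hdisj : Disjoint (cutBoundary A C₁) (cutBoundary A (C \ C₁)) :=
    Set.disjoint_left.mpr fun p h1 h2 => h2.1.2 h1.1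
  have hfin₁ : (cutBoundary A C₁).Finite := h.finite.subset (hbd ▸ Set.subset_union_left)
  have hfin₂ : (cutBoundary A (C \ C₁)).Finite := h.finite.subset (hbd ▸ Set.subset_union_right)
  have hcard := Set.ncard_union_eq hdisj hfin₁ hfin₂
  rw [← hbd] at hcard
  have hu : C₁ ∪ C \ C₁ ∈ u := by
    rw [Set.union_sdiff_cancel hsub]
    exact h.mem
  rcases Ultrafilter.union_mem_iff.mp hu with hu | hu
  · have h1 := h.le_ncard C₁ hu (fun h2 => h.notMem (Filter.mem_of_superset h2 hsub)) hfin₁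
    have h2 : cutBoundary A (C \ C₁) = ∅ := (Set.ncard_eq_zero hfin₂).mp (by omega)
    by_contra hxy
    have h3 := eq_univ_of_cutBoundary_eq_empty hgen (C := C \ C₁) (x := y) ⟨hy, hxy⟩ h2
    have h4 : x ∈ C \ C₁ := h3 ▸ Set.mem_univ x
    exact h4.2 Relation.ReflTransGen.refl
  · have h1 := h.le_ncard _ hu (fun h2 => h.notMem (Filter.mem_of_superset h2 Set.sdiff_subset))
      hfin₂
    have h2 : cutBoundary A C₁ = ∅ := (Set.ncard_eq_zero hfin₁).mp (by omega)
    have h3 := eq_univ_of_cutBoundary_eq_empty hgen (x := x) Relation.ReflTransGen.refl h2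
    exact absurd (Set.univ_subset_iff.mp (h3 ▸ hsub)) h.ne_univ

end IsMinCut

end Cuts

section Nested

variable {α : Type*}

/-- Two subsets are nested if one of the four corners they determine is empty. -/
def Nested (C D : Set α) : Prop := C ⊆ D ∨ C ⊆ Dᶜ ∨ Cᶜ ⊆ D ∨ Cᶜ ⊆ Dᶜ

theorem Nested.symm {C D : Set α} (h : Nested C D) : Nested D C := by
  rcases h with h | h | h | h
  · exact Or.inr (Or.inr (Or.inr (Set.compl_subset_compl.mpr h)))
  · exact Or.inr (Or.inl (Set.subset_compl_comm.mp h))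
  · exact Or.inr (Or.inr (Or.inl (Set.compl_subset_comm.mp h)))
  · exact Or.inl (Set.compl_subset_compl.mp h)

theorem nested_compl_left {C D : Set α} : Nested Cᶜ D ↔ Nested C D := by
  unfold Nested
  rw [compl_compl]
  tauto

theorem nested_compl_right {C D : Set α} : Nested C Dᶜ ↔ Nested C D := by
  unfold Nested
  rw [compl_compl]
  tauto

theorem nested_smul {G : Type*} [Group G] {g : G} {C D : Set G} :
    Nested (g • C) (g • D) ↔ Nested C D := by
  simp only [Nested, ← Set.smul_set_compl, Set.smul_set_subset_smul_set_iff]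

theorem Nested.inter_of_left {C D F : Set α} (h : Nested C F) (h' : Nested D F)
    (hCD : ¬ Nested C D) : Nested (C ∩ D) F := by
  rcases h with h | h | h | h
  · exact Or.inl (Set.inter_subset_left.trans h)
  · exact Or.inr (Or.inl (Set.inter_subset_left.trans h))
  all_goals
    rcases h' with h' | h' | h' | h'
    · exact Or.inl (Set.inter_subset_right.trans h')
    · exact Or.inr (Or.inl (Set.inter_subset_right.trans h'))
  · exact Or.inr (Or.inr (Or.inl (by rw [Set.compl_inter]; exact Set.union_subset h h')))
  · exact absurd (Or.inr (Or.inr (Or.inl (h.trans (Set.subset_compl_comm.mp h' |>.trans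
      (compl_compl D).subset))))) hCD
  · exact absurd (Or.inr (Or.inr (Or.inl (h.trans (Set.compl_subset_comm.mp h'))))) hCD
  · exact Or.inr (Or.inr (Or.inr (by rw [Set.compl_inter]; exact Set.union_subset h h')))

end Nested

section Crossing

variable {G : Type*} [Group G] {A : Set G} {K c : ℕ}

/-- The minimal cuts of capacity at most `K`. -/
def minCuts (A : Set G) (K : ℕ) : Set (Set G) := {C | ∃ u v, IsMinCut A K u v C}

theorem compl_mem_minCuts {C : Set G} (h : C ∈ minCuts A K) : Cᶜ ∈ minCuts A K :=
  let ⟨u, v, h⟩ := h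
  ⟨v, u, h.compl⟩

theorem smul_mem_minCuts (g : G) {C : Set G} (h : C ∈ minCuts A K) : g • C ∈ minCuts A K :=
  let ⟨_, _, h⟩ := h
  ⟨_, _, h.smul g⟩

theorem exists_cutBoundary_near (hgen : Subgroup.closure A = ⊤) (hb : Bottleneck A c)
    {C : Set G} (hC : C ∈ minCuts A K) {p q : G × G} (hp : p ∈ cutBoundary A C)
    (hq : q ∈ cutBoundary A C) {z : G}
    (hz : wordDist A p.1 z + wordDist A z q.1 = wordDist A p.1 q.1) :
    ∃ e ∈ cutBoundary A C, wordDist A z e.1 ≤ c := by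
  obtain ⟨u, v, hC⟩ := hC
  obtain ⟨w, hw, hzw⟩ := hb p.1 q.1 z C hz hp.1 (hC.connected hgen hp.1 hq.1)
  have hpath : Relation.ReflTransGen
      (fun a b => CayleyAdj A a b ∧ b ∈ insert p.1 (insert q.1 Cᶜ)) p.1 q.1 := by
    refine (Relation.ReflTransGen.head ⟨hp.2.2, Or.inr (Or.inr hp.2.1)⟩ ?_).tail
      ⟨hq.2.2.symm, Or.inr (Or.inl rfl)⟩
    exact Relation.ReflTransGen.mono (fun a b h => ⟨h.1, Or.inr (Or.inr h.2)⟩) _ _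
      (hC.compl.connected hgen hp.2.1 hq.2.1)
  obtain ⟨w', hw' | hw' | hw', hzw'⟩ := hb p.1 q.1 z _ hz (Set.mem_insert _ _) hpath
  · exact ⟨p, hp, hw' ▸ hzw'⟩
  · exact ⟨q, hq, hw' ▸ hzw'⟩
  · by_cases hzC : z ∈ C
    · obtain ⟨e, he, h, -⟩ := exists_cutBoundary_between hgen hzC hw'
      exact ⟨e, he, by omega⟩
    · obtain ⟨e, he, h, -⟩ := exists_cutBoundary_between hgen hw hzC
      have h1 := wordDist_comm hgen w z
      have h2 := wordDist_comm hgen e.1 z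
      exact ⟨e, he, by omega⟩

/-- The boundaries of the minimal cuts are uniformly bounded. -/
theorem wordDist_fst_le (hgen : Subgroup.closure A = ⊤) (hb : Bottleneck A c)
    {C : Set G} (hC : C ∈ minCuts A K) {p q : G × G} (hp : p ∈ cutBoundary A C)
    (hq : q ∈ cutBoundary A C) : wordDist A p.1 q.1 ≤ (2 * c + 1) * K := by
  by_contra! hlt
  have hbound : ∀ i : Fin (K + 1), i * (2 * c + 1) ≤ wordDist A p.1 q.1 := fun i => by
    refine le_trans ?_ hlt.le
    rw [mul_comm]
    exact Nat.mul_le_mul_left _ (Nat.lt_succ_iff.mp i.2)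
  choose z hz1 hz2 using fun i : Fin (K + 1) => exists_wordDist_between hgen p.1 q.1 (hbound i)
  choose e he hze using fun i => exists_cutBoundary_near hgen hb hC hp hq (z := z i)
    (by have := hbound i; rw [hz1, hz2]; omega)
  have hlt' : ∀ i j, i < j → e i ≠ e j := fun i j hij heq => by
    have h1 := wordDist_triangle hgen p.1 (z i) (z j)
    have h2 := wordDist_triangle hgen (z i) (e j).1 (z j)
    have h3 := hze i
    have h4 := hze j
    have h5 := wordDist_comm hgen (z j) (e j).1
    rw [hz1, hz1] at h1
    rw [heq] at h3
    have h6 : ((i : ℕ) + 1) * (2 * c + 1) ≤ j * (2 * c + 1) := Nat.mul_le_mul_right _ hij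
    rw [add_mul] at h6
    omega
  have hinj : Function.Injective e := fun i j hij => by
    rcases lt_trichotomy i j with h | h | h
    · exact absurd hij (hlt' i j h)
    · exact h
    · exact absurd hij.symm (hlt' j i h)
  obtain ⟨u, v, hC⟩ := hC
  have h1 : (Set.range e).ncard ≤ (cutBoundary A C).ncard :=
    Set.ncard_le_ncard (Set.range_subset_iff.mpr he) hC.finite
  have h2 := Nat.card_range_of_injective hinj
  rw [Nat.card_coe_set_eq, Nat.card_eq_fintype_card, Fintype.card_fin] at h2
  have := hC.ncard_le
  omega

theorem finite_adj_near (hA : A.Finite) (hgen : Subgroup.closure A = ⊤) (x : G) (n : ℕ) :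
    {p : G × G | wordDist A x p.1 ≤ n ∧ CayleyAdj A p.1 p.2}.Finite := by
  refine ((finite_wordDist_le hA hgen x n).biUnion fun a _ =>
    (finite_cayleyAdj hA a).image (Prod.mk a)).subset fun p hp => ?_
  exact Set.mem_biUnion hp.1 ⟨p.2, hp.2, rfl⟩

/-- Only finitely many minimal cuts separate two given points. -/
theorem finite_minCuts_between (hA : A.Finite) (hgen : Subgroup.closure A = ⊤)
    (hb : Bottleneck A c) (x y : G) : {D ∈ minCuts A K | x ∈ D ∧ y ∉ D}.Finite := by
  refine Set.Finite.of_finite_image (f := cutBoundary A)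
    ((finite_adj_near hA hgen x (wordDist A x y + (2 * c + 1) * K)).finite_subsets.subset ?_) ?_
  · rintro _ ⟨D, ⟨hD, hx, hy⟩, rfl⟩ q hq
    obtain ⟨p, hp, h, -⟩ := exists_cutBoundary_between hgen hx hy
    have h1 := wordDist_fst_le hgen hb hD hp hq
    have h2 := wordDist_triangle hgen x p.1 q.1
    exact ⟨by omega, hq.2.2⟩
  · rintro D ⟨⟨u, v, hD⟩, -⟩ E - hDE
    exact eq_of_cutBoundary_eq hgen hDE (hD.nonempty_cutBoundary hgen)

theorem exists_cutBoundary_fst_mem (hgen : Subgroup.closure A = ⊤) {C D : Set G}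
    (hD : D ∈ minCuts A K) (h1 : ¬ D ⊆ C) (h2 : ¬ D ⊆ Cᶜ) : ∃ p ∈ cutBoundary A C, p.1 ∈ D := by
  obtain ⟨y, hy, hyC⟩ := Set.not_subset.mp h1
  obtain ⟨x, hx, hxC⟩ := Set.not_subset.mp h2
  obtain ⟨u, v, hD⟩ := hD
  obtain ⟨a, b, h, ha, hb⟩ := exists_mem_of_reflTransGen
    (reflTransGen_and_mem (hD.connected hgen hx hy) hx).1 (Set.notMem_compl_iff.mp hxC) hyC
  exact ⟨(a, b), ⟨ha, hb, h.1⟩, h.2.1⟩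

theorem finite_not_nested (hA : A.Finite) (hgen : Subgroup.closure A = ⊤)
    (hb : Bottleneck A c) {C : Set G} (hC : C ∈ minCuts A K) :
    {F ∈ minCuts A K | ¬ Nested C F}.Finite := by
  obtain ⟨u, v, hC⟩ := hC
  refine (hC.finite.biUnion fun p _ => hC.finite.biUnion fun q _ =>
    finite_minCuts_between (K := K) hA hgen hb p.1 q.1).subset fun F ⟨hF, hn⟩ => ?_
  have hn' : ¬ Nested F C := fun h => hn h.symm
  simp only [Nested, not_or] at hn'
  obtain ⟨p, hp, hpF⟩ := exists_cutBoundary_fst_mem hgen hF hn'.1 hn'.2.1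
  obtain ⟨q, hq, hqF⟩ := exists_cutBoundary_fst_mem hgen (compl_mem_minCuts hF)
    hn'.2.2.1 hn'.2.2.2
  exact Set.mem_biUnion hp (Set.mem_biUnion hq ⟨hF, hpF, hqF⟩)

/-- The number of minimal cuts which cross `C`. -/
noncomputable def crossNum (A : Set G) (K : ℕ) (C : Set G) : ℕ :=
  {F ∈ minCuts A K | ¬ Nested C F}.ncard

theorem crossNum_compl (C : Set G) : crossNum A K Cᶜ = crossNum A K C := by
  simp only [crossNum, nested_compl_left]

theorem crossNum_smul (g : G) (C : Set G) : crossNum A K (g • C) = crossNum A K C := by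
  have : {F ∈ minCuts A K | ¬ Nested (g • C) F} =
      (g • ·) '' {F ∈ minCuts A K | ¬ Nested C F} := by
    ext F
    constructor
    · rintro ⟨hF, h⟩
      refine ⟨g⁻¹ • F, ⟨smul_mem_minCuts _ hF, ?_⟩, smul_inv_smul g F⟩
      rwa [← nested_smul (g := g), smul_inv_smul]
    · rintro ⟨F, ⟨hF, h⟩, rfl⟩
      exact ⟨smul_mem_minCuts _ hF, by rwa [nested_smul]⟩
  rw [crossNum, this, Set.ncard_image_of_injective _ (MulAction.injective g), crossNum]

theorem crossNum_inter_add_lt (hA : A.Finite) (hgen : Subgroup.closure A = ⊤)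
    (hb : Bottleneck A c) {C D : Set G} (hC : C ∈ minCuts A K) (hD : D ∈ minCuts A K)
    (hCD : ¬ Nested C D) :
    crossNum A K (C ∩ D) + crossNum A K (Cᶜ ∩ Dᶜ) < crossNum A K C + crossNum A K D := by
  refine ncard_add_ncard_lt_of_subset (finite_not_nested hA hgen hb hC)
    (finite_not_nested hA hgen hb hD) ⟨?_, fun h => ?_⟩ ?_
  · rintro F (⟨hF, h⟩ | ⟨hF, h⟩)
    · by_contra! hcon
      simp only [Set.mem_union, Set.mem_ofPred_eq, hF, true_and, not_or, not_not] at hcon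
      exact h (hcon.1.inter_of_left hcon.2 hCD)
    · by_contra! hcon
      simp only [Set.mem_union, Set.mem_ofPred_eq, hF, true_and, not_or, not_not] at hcon
      refine h (Nested.inter_of_left (nested_compl_left.mpr hcon.1)
        (nested_compl_left.mpr hcon.2) ?_)
      rwa [nested_compl_left, nested_compl_right]
  · rcases h (Or.inr ⟨hC, fun h => hCD h.symm⟩) with h | h
    · exact h.2 (Or.inl Set.inter_subset_left)
    · exact h.2 (Or.inr (Or.inl Set.inter_subset_left))
  · rintro F ⟨⟨hF, h1⟩, -, h2⟩
    simp only [Nested, not_or] at h1 h2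
    refine ⟨⟨hF, ?_⟩, ⟨hF, ?_⟩⟩
    · rintro (h | h | h | h)
      · exact h1.1 (Set.inter_subset_left.trans h)
      · exact h1.2.1 (Set.inter_subset_left.trans h)
      · exact h2.1 (Set.inter_subset_left.trans h)
      · exact h2.2.1 (Set.inter_subset_left.trans h)
    · rintro (h | h | h | h)
      · exact h1.1 (Set.inter_subset_right.trans h)
      · exact h1.2.1 (Set.inter_subset_right.trans h)
      · exact h2.1 (Set.inter_subset_right.trans h)
      · exact h2.2.1 (Set.inter_subset_right.trans h)

/-- A minimal cut separating `u` and `v` which crosses as few minimal cuts as possible. -/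
structure IsOptCut (A : Set G) (K : ℕ) (u v : Ultrafilter G) (C : Set G) : Prop
    extends IsMinCut A K u v C where
  crossNum_le : ∀ C', IsMinCut A K u v C' → crossNum A K C ≤ crossNum A K C'

namespace IsOptCut

variable {u v s t : Ultrafilter G} {C D : Set G}

theorem compl (h : IsOptCut A K u v C) : IsOptCut A K v u Cᶜ where
  toIsMinCut := h.toIsMinCut.compl
  crossNum_le C' h' := by
    rw [crossNum_compl, ← crossNum_compl C']
    exact h.crossNum_le _ h'.compl

theorem smul (h : IsOptCut A K u v C) (g : G) :
    IsOptCut A K (u.map (g * ·)) (v.map (g * ·)) (g • C) where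
  toIsMinCut := h.toIsMinCut.smul g
  crossNum_le C' h' := by
    have hmap : ∀ w : Ultrafilter G, (w.map (g * ·)).map (g⁻¹ * ·) = w := fun w => by
      rw [Ultrafilter.map_map]
      convert Ultrafilter.map_id w
      ext x
      simp
    have := h'.smul g⁻¹
    rw [hmap, hmap] at this
    rw [crossNum_smul, ← crossNum_smul g⁻¹ C']
    exact h.crossNum_le _ this

theorem ncard_inter_ge (h : IsOptCut A K u v C) (hD : (cutBoundary A D).Finite) (hu : D ∈ u) :
    (cutBoundary A C).ncard ≤ (cutBoundary A (C ∩ D)).ncard ∧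
      ((cutBoundary A (C ∩ D)).ncard = (cutBoundary A C).ncard →
        crossNum A K C ≤ crossNum A K (C ∩ D)) := by
  have hu' : C ∩ D ∈ u := Filter.inter_mem h.mem hu
  have hv' : C ∩ D ∉ v := fun h1 => h.notMem (Filter.mem_of_superset h1 Set.inter_subset_left)
  have hf := (h.finite.union hD).subset (cutBoundary_inter_subset C D)
  refine ⟨h.le_ncard _ hu' hv' hf, fun heq => h.crossNum_le _ ⟨hu', hv', hf, ?_, ?_⟩⟩
  · exact heq ▸ h.ncard_le
  · exact heq ▸ h.le_ncard

/-- Optimal cuts are nested. -/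
theorem nested (hA : A.Finite) (hgen : Subgroup.closure A = ⊤) (hb : Bottleneck A c)
    (hC : IsOptCut A K u v C) (hD : IsOptCut A K s t D) : Nested C D := by
  by_contra hCD
  have hC' : C ∈ minCuts A K := ⟨_, _, hC.toIsMinCut⟩
  have hD' : D ∈ minCuts A K := ⟨_, _, hD.toIsMinCut⟩
  have hcD := finite_cutBoundary_compl hD.finite
  have hcC := finite_cutBoundary_compl hC.finite
  have e1 := ncard_cutBoundary_inter_add_le hC.finite hD.finite
  have e2 := ncard_cutBoundary_inter_add_le hC.finite hcD
  have e3 := crossNum_inter_add_lt hA hgen hb hC' hD' hCD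
  have e4 := crossNum_inter_add_lt hA hgen hb hC' (compl_mem_minCuts hD')
    (fun h => hCD (nested_compl_right.mp h))
  have u1 := hC.ncard_inter_ge hD.finite
  have u2 := hC.ncard_inter_ge hcD
  have v1 := hC.compl.ncard_inter_ge hD.finite
  have v2 := hC.compl.ncard_inter_ge hcD
  have s1 := hD.ncard_inter_ge hC.finite
  have s2 := hD.ncard_inter_ge hcC
  have t1 := hD.compl.ncard_inter_ge hC.finite
  have t2 := hD.compl.ncard_inter_ge hcC
  simp only [Ultrafilter.compl_mem_iff_notMem, ncard_cutBoundary_compl, crossNum_compl,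
    compl_compl, Set.inter_comm D, Set.inter_comm Dᶜ] at *
  by_cases hu : D ∈ u <;> by_cases hv : D ∈ v <;> by_cases hs : C ∈ s <;> by_cases ht : C ∈ t <;>
    simp only [hu, hv, hs, ht, not_true_eq_false, not_false_eq_true, forall_true_left,
      forall_false] at u1 u2 v1 v2 s1 s2 t1 t2 <;> omega

theorem exists_of_finite {X : Set G} (hu : X ∈ u) (hv : X ∉ v) (hX : (cutBoundary A X).Finite)
    (hK : (cutBoundary A X).ncard ≤ K) : ∃ C, IsOptCut A K u v C := by
  obtain ⟨C, hC, hmin⟩ := exists_minimalFor_of_wellFoundedLT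
    (fun C => C ∈ u ∧ C ∉ v ∧ (cutBoundary A C).Finite) (fun C => (cutBoundary A C).ncard)
    ⟨X, hu, hv, hX⟩
  have hle : ∀ C', C' ∈ u → C' ∉ v → (cutBoundary A C').Finite →
      (cutBoundary A C).ncard ≤ (cutBoundary A C').ncard := fun C' h1 h2 h3 => by
    rcases le_total (cutBoundary A C).ncard (cutBoundary A C').ncard with h | h
    · exact h
    · exact hmin ⟨h1, h2, h3⟩ h
  obtain ⟨D, hD, hmin'⟩ := exists_minimalFor_of_wellFoundedLT
    (fun C => IsMinCut A K u v C) (crossNum A K)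
    ⟨C, hC.1, hC.2.1, hC.2.2, (hle X hu hv hX).trans hK, hle⟩
  refine ⟨D, hD, fun C' h' => ?_⟩
  rcases le_total (crossNum A K D) (crossNum A K C') with h | h
  · exact h
  · exact hmin' h' h

end IsOptCut

end Crossing

section CutExistence

variable {G : Type*} [Group G] {A : Set G} {c : ℕ}

/-- A bound for the capacity of the cuts obtained by removing a ball of radius `c`. -/
noncomputable def cutBound (A : Set G) (c : ℕ) : ℕ :=
  {p : G × G | wordDist A 1 p.1 ≤ c + 1 ∧ CayleyAdj A p.1 p.2}.ncard

theorem exists_infinite_fiber {α : Type*} {f : ℕ → α} (h : (Set.range f).Finite) :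
    ∃ a, {n | f n = a}.Infinite := by
  by_contra hcon
  simp only [not_exists, Set.not_infinite] at hcon
  exact Set.infinite_univ ((h.biUnion fun a _ => hcon a).subset fun n _ =>
    Set.mem_biUnion (Set.mem_range_self n) rfl)

theorem infinite_of_unbounded {S : Set G} (h : ∀ n, ∃ x ∈ S, n ≤ wordDist A 1 x) :
    S.Infinite := fun hfin => by
  obtain ⟨B, hB⟩ := (hfin.image (wordDist A 1)).bddAbove
  obtain ⟨x, hx, hn⟩ := h (B + 1)
  have := hB (Set.mem_image_of_mem _ hx)
  omega

theorem exists_cut_infinite (hA : A.Finite) (hgen : Subgroup.closure A = ⊤) (hb : Bottleneck A c)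
    {Y : Set G} (hY : ∀ n, ∃ x ∈ Y, ∃ y ∈ Y, n ≤ wordDist A 1 x ∧ n ≤ wordDist A 1 y ∧
      wordDist A x 1 + wordDist A 1 y = wordDist A x y) :
    ∃ Q : Set G, (cutBoundary A Q).Finite ∧ (cutBoundary A Q).ncard ≤ cutBound A c ∧
      (Y ∩ Q).Infinite ∧ (Y ∩ Qᶜ).Infinite := by
  choose x hx y hy hnx hny hxy using fun n => hY (n + c + 1)
  let T : Set G := {z | c < wordDist A 1 z}
  let Q : ℕ → Set G := fun n => {z | Relation.ReflTransGen (fun a b => CayleyAdj A a b ∧ b ∈ T)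
    (x n) z}
  have hxT : ∀ n, x n ∈ T := fun n => by
    have := hnx n
    simp only [T, Set.mem_ofPred_eq]
    omega
  have hyQ : ∀ n, y n ∉ Q n := fun n h => by
    obtain ⟨w, hw, hwc⟩ := hb (x n) (y n) 1 T (hxy n) (hxT n) h
    exact absurd hw (not_lt.mpr hwc)
  have hS := finite_adj_near hA hgen 1 (c + 1)
  have hsub : ∀ n, cutBoundary A (Q n) ⊆
      {p : G × G | wordDist A 1 p.1 ≤ c + 1 ∧ CayleyAdj A p.1 p.2} := fun n p hp => by
    refine ⟨?_, hp.2.2⟩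
    have h1 : p.2 ∉ T := fun h => hp.2.1 (Relation.ReflTransGen.tail hp.1 ⟨hp.2.2, h⟩)
    have h2 : wordDist A 1 p.2 ≤ c := not_lt.mp h1
    have h3 := wordDist_triangle hgen 1 p.2 p.1
    have h4 := hp.2.2.symm.wordDist_le_one
    omega
  have hfin : (Set.range Q).Finite := by
    refine Set.Finite.of_finite_image (f := cutBoundary A) (hS.finite_subsets.subset ?_) ?_
    · rintro _ ⟨_, ⟨n, rfl⟩, rfl⟩
      exact hsub n
    · rintro _ ⟨n, rfl⟩ _ ⟨m, rfl⟩ h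
      obtain ⟨p, hp, -⟩ := exists_cutBoundary_between hgen (C := Q n) (x := x n)
        Relation.ReflTransGen.refl (hyQ n)
      exact eq_of_cutBoundary_eq hgen h ⟨p, hp⟩
  obtain ⟨Q₀, hQ₀⟩ := exists_infinite_fiber hfin
  obtain ⟨n₀, rfl⟩ := hQ₀.nonempty
  refine ⟨Q n₀, hS.subset (hsub n₀), Set.ncard_le_ncard (hsub n₀) hS,
    infinite_of_unbounded (A := A) fun n => ?_, infinite_of_unbounded (A := A) fun n => ?_⟩
  all_goals
    obtain ⟨m, hm, hnm⟩ := hQ₀.exists_gt n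
  · have := hnx m
    exact ⟨x m, ⟨hx m, hm ▸ Relation.ReflTransGen.refl⟩, by omega⟩
  · have := hny m
    exact ⟨y m, ⟨hy m, hm ▸ hyQ m⟩, by omega⟩

theorem Ultrafilter.exists_mem_of_infinite {α : Type*} {S : Set α} (hS : S.Infinite) :
    ∃ u : Ultrafilter α, S ∈ u ∧ ∀ T ∈ u, T.Infinite := by
  have := hS.cofinite_inf_principal_neBot
  let u := Ultrafilter.of (Filter.cofinite ⊓ Filter.principal S)
  have hu : (u : Filter α) ≤ Filter.cofinite ⊓ Filter.principal S := Ultrafilter.of_le _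
  refine ⟨u, hu (Filter.mem_inf_of_right (Filter.mem_principal_self S)), fun T hT hfin => ?_⟩
  have h1 : Tᶜ ∈ u := hu (Filter.mem_inf_of_left hfin.compl_mem_cofinite)
  exact Ultrafilter.compl_mem_iff_notMem.mp h1 hT

theorem exists_isOptCut_infinite (hA : A.Finite) (hgen : Subgroup.closure A = ⊤)
    (hb : Bottleneck A c) {Y : Set G} (hY : ∀ n, ∃ x ∈ Y, ∃ y ∈ Y, n ≤ wordDist A 1 x ∧
      n ≤ wordDist A 1 y ∧ wordDist A x 1 + wordDist A 1 y = wordDist A x y) :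
    ∃ E u v, IsOptCut A (cutBound A c) u v E ∧ (Y ∩ E).Infinite ∧ (Y ∩ Eᶜ).Infinite := by
  obtain ⟨Q, hfin, hcard, h1, h2⟩ := exists_cut_infinite hA hgen hb hY
  obtain ⟨u, hu, hu'⟩ := Ultrafilter.exists_mem_of_infinite h1
  obtain ⟨v, hv, hv'⟩ := Ultrafilter.exists_mem_of_infinite h2
  have hvQ : Qᶜ ∈ v := Filter.mem_of_superset hv Set.inter_subset_right
  obtain ⟨E, hE⟩ := IsOptCut.exists_of_finite (Filter.mem_of_superset hu Set.inter_subset_right)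
    (Ultrafilter.compl_mem_iff_notMem.mp hvQ) hfin hcard
  exact ⟨E, u, v, hE,
    hu' _ (Filter.inter_mem (Filter.mem_of_superset hu Set.inter_subset_left) hE.mem),
    hv' _ (Filter.inter_mem (Filter.mem_of_superset hv Set.inter_subset_left) hE.compl.mem)⟩

theorem exists_isOptCut [Nontrivial G] (hA : A.Finite) (hgen : Subgroup.closure A = ⊤) :
    ∃ E u v, IsOptCut A (cutBound A c) u v E := by
  obtain ⟨y, hy⟩ := exists_ne (1 : G)
  have hS := finite_adj_near hA hgen 1 (c + 1)
  have hsub : cutBoundary A ({1} : Set G) ⊆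
      {p : G × G | wordDist A 1 p.1 ≤ c + 1 ∧ CayleyAdj A p.1 p.2} := by
    rintro p ⟨h1, -, h2⟩
    refine ⟨?_, h2⟩
    rw [Set.mem_singleton_iff.mp h1, wordDist_self]
    omega
  obtain ⟨E, hE⟩ := IsOptCut.exists_of_finite (K := cutBound A c) (u := (pure 1 : Ultrafilter G))
    (v := (pure y : Ultrafilter G)) (Ultrafilter.mem_pure.mpr (Set.mem_singleton 1))
    (fun h => hy (Ultrafilter.mem_pure.mp h)) (hS.subset hsub) (Set.ncard_le_ncard hsub hS)
  exact ⟨E, _, _, hE⟩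

end CutExistence

section OptCuts

variable {G : Type*} [Group G] {A : Set G} {K c : ℕ}

/-- The optimal cuts of capacity at most `K`. -/
abbrev OptCut (A : Set G) (K : ℕ) : Type _ := {C : Set G // ∃ u v, IsOptCut A K u v C}

namespace OptCut

/-- The complement of an optimal cut. -/
def compl (D : OptCut A K) : OptCut A K := ⟨D.1ᶜ, let ⟨u, v, h⟩ := D.2; ⟨v, u, h.compl⟩⟩

instance : MulAction G (OptCut A K) where
  smul g D := ⟨g • D.1, let ⟨_, _, h⟩ := D.2; ⟨_, _, h.smul g⟩⟩
  one_smul D := Subtype.ext (one_smul G D.1)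
  mul_smul g h D := Subtype.ext (mul_smul g h D.1)

theorem coe_smul (g : G) (D : OptCut A K) : (g • D).1 = g • D.1 := rfl

theorem mem_minCuts (D : OptCut A K) : D.1 ∈ minCuts A K :=
  let ⟨u, v, h⟩ := D.2
  ⟨u, v, h.toIsMinCut⟩

theorem smul_le (g : G) (D E : OptCut A K) (h : D ≤ E) : g • D ≤ g • E :=
  Set.smul_set_mono (a := g) (show D.1 ⊆ E.1 from h)

theorem compl_smul (g : G) (D : OptCut A K) : (g • D).compl = g • D.compl :=
  Subtype.ext (Set.smul_set_compl (a := g) (s := D.1)).symm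

theorem finite_between (hA : A.Finite) (hgen : Subgroup.closure A = ⊤)
    (hb : Bottleneck A c) (x y : G) : {D : OptCut A K | x ∈ D.1 ∧ y ∉ D.1}.Finite :=
  ((finite_minCuts_between (K := K) hA hgen hb x y).preimage
    Subtype.val_injective.injOn).subset fun D hD => ⟨mem_minCuts D, hD⟩

theorem isTreePocset (hA : A.Finite) (hgen : Subgroup.closure A = ⊤) (hb : Bottleneck A c) :
    IsTreePocset (OptCut.compl : OptCut A K → OptCut A K) (fun D => 1 ∉ D.1) where
  compl_compl D := Subtype.ext (compl_compl D.1)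
  compl_le h := Set.compl_subset_compl.mpr h
  nested D E :=
    let ⟨_, _, hD⟩ := D.2
    let ⟨_, _, hE⟩ := E.2
    hD.nested hA hgen hb hE
  not_le_compl {D E} h h' := by
    obtain ⟨u, v, hD⟩ := D.2
    obtain ⟨x, hx⟩ := hD.nonempty
    exact h' hx (h hx)
  out_compl D := Iff.rfl
  out_of_le h h' h1 := h' (h h1)
  finite_out D _ := by
    obtain ⟨u, v, hD⟩ := D.2
    obtain ⟨x, hx⟩ := hD.nonempty
    exact (finite_between hA hgen hb x 1).subset fun F hF => ⟨hF.2 hx, hF.1⟩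
  finite_Icc D E := by
    obtain ⟨u, v, hD⟩ := D.2
    obtain ⟨u', v', hE⟩ := E.2
    obtain ⟨x, hx⟩ := hD.nonempty
    obtain ⟨y, hy⟩ := hE.compl.nonempty
    exact (finite_between hA hgen hb x y).subset fun F hF => ⟨hF.1 hx, fun h => hy (hF.2 h)⟩

/-- Only finitely many optimal cuts have an edge near the identity in their boundary. -/
theorem finite_near (hA : A.Finite) (hgen : Subgroup.closure A = ⊤) (hb : Bottleneck A c)
    (n : ℕ) : {D : OptCut A K | ∃ p ∈ cutBoundary A D.1, wordDist A 1 p.1 ≤ n}.Finite :=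
  ((finite_adj_near hA hgen 1 n).biUnion fun p _ => finite_between hA hgen hb p.1 p.2).subset
    fun _ ⟨_, hp, hn⟩ => Set.mem_biUnion ⟨hn, hp.2.2⟩ ⟨hp.1, hp.2.1⟩

/-- The group elements incident to the boundaries of a family of optimal cuts. -/
def support (s : Set (OptCut A K)) : Set G := {x | ∃ F ∈ s, ∃ q, (x, q) ∈ cutBoundary A F.1}

theorem mul_mem_support {s : Set (OptCut A K)} (g : G) {x : G} (hx : x ∈ support s) :
    g * x ∈ support (g • s) := by
  obtain ⟨F, hF, q, hq⟩ := hx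
  refine ⟨g • F, Set.smul_mem_smul_set hF, g * q, ?_⟩
  rw [coe_smul, cutBoundary_smul]
  exact ⟨_, hq, rfl⟩

theorem nonempty_cutBoundary (hgen : Subgroup.closure A = ⊤) (D : OptCut A K) :
    (cutBoundary A D.1).Nonempty :=
  let ⟨_, _, h⟩ := D.2
  h.nonempty_cutBoundary hgen

theorem finite_stabilizer (hgen : Subgroup.closure A = ⊤) {s : Set (OptCut A K)} {D : OptCut A K}
    (hD : D ∈ s) (hs : (support s).Finite) {H : Subgroup G} (hH : ∀ h ∈ H, h • s = s) :
    Finite H := by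
  obtain ⟨p, hp⟩ := D.nonempty_cutBoundary hgen
  have := hs.to_subtype
  let f : H → support s := fun h =>
    ⟨h * p.1, by simpa only [hH h h.2] using mul_mem_support (h : G) ⟨D, hD, p.2, hp⟩⟩
  refine Finite.of_injective f fun a b hab => ?_
  exact Subtype.ext (mul_right_cancel (Subtype.ext_iff.mp hab))

open IsTreePocset

/-- The optimal cuts ending at a vertex of the tree. -/
abbrev star (v : Set (OptCut A K)) : Set (OptCut A K) := {F | vertex OptCut.compl F = v}

theorem smul_star (g : G) (v : Set (OptCut A K)) : g • star v = star (g • v) := by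
  ext F
  rw [Set.mem_smul_set_iff_inv_smul_mem]
  simp only [star, Set.mem_ofPred_eq, ← smul_vertex smul_le compl_smul, inv_smul_eq_iff]

theorem finite_support_star_inter_compl {D E : OptCut A K}
    (hE : E ∈ vertex OptCut.compl D) :
    (support (star (vertex OptCut.compl D)) ∩ E.1ᶜ).Finite := by
  obtain ⟨u, v, hE'⟩ := E.2
  refine (hE'.finite.image Prod.snd).subset ?_
  rintro x ⟨⟨F, hF, q, hx, hq, hxq⟩, hxE⟩
  rw [star, Set.mem_ofPred_eq] at hF
  rw [← hF] at hE
  rcases hE with hE | hE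
  · exact absurd (hE hx) hxE
  · exact ⟨(q, x), ⟨hE.le hq, hxE, hxq.symm⟩, rfl⟩

theorem exists_wordDist_le_one {D E : OptCut A K} (hE : E ∈ vertex OptCut.compl D) {x : G}
    (hx : x ∈ support (star (vertex OptCut.compl D))) : ∃ x' ∈ E.1, wordDist A x x' ≤ 1 := by
  obtain ⟨F, hF, q, hxF, hq, hxq⟩ := hx
  rw [star, Set.mem_ofPred_eq] at hF
  rw [← hF] at hE
  rcases hE with hE | hE
  · exact ⟨x, hE hxF, by rw [wordDist_self]; omega⟩
  · exact ⟨q, hE.le hq, hxq.wordDist_le_one⟩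

theorem smul_vertex_mem_of_between (hA : A.Finite) (hgen : Subgroup.closure A = ⊤)
    (hb : Bottleneck A c) (D : OptCut A K) {x y z : G}
    (hx : x ∈ support (star (vertex OptCut.compl D)))
    (hy : y ∈ support (star (vertex OptCut.compl D)))
    (hz : wordDist A x z + wordDist A z y = wordDist A x y) :
    z⁻¹ • vertex OptCut.compl D ∈ insert {F : OptCut A K | 1 ∈ F.1} (vertex OptCut.compl ''
      {F | ∃ p ∈ cutBoundary A F.1, wordDist A 1 p.1 ≤ (2 * c + 1) * K + 4}) := by
  have ht := isTreePocset (K := K) hA hgen hb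
  by_cases hall : ∀ E ∈ vertex OptCut.compl D, z ∈ E.1
  · left
    ext F
    rw [Set.mem_smul_set_iff_inv_smul_mem, inv_inv, Set.mem_ofPred_eq]
    have hiff : 1 ∈ F.1 ↔ z ∈ (z • F).1 := by
      rw [coe_smul, Set.mem_smul_set_iff_inv_smul_mem, smul_eq_mul, inv_mul_cancel]
    rw [hiff]
    refine ⟨hall _, fun h => ?_⟩
    by_contra hcon
    exact hall _ ((ht.compl_mem_vertex_iff).mpr hcon) h
  · right
    push Not at hall
    obtain ⟨E, hE, hzE⟩ := hall
    obtain ⟨E₀, hle, hE₀⟩ := ht.exists_le_vertex_eq hE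
    have hzE₀ : z ∉ E₀.1 := fun h => hzE (hle h)
    have hmem : E₀ ∈ vertex OptCut.compl D := hE₀ ▸ self_mem_vertex E₀
    obtain ⟨x', hx', hxx'⟩ := exists_wordDist_le_one hmem hx
    obtain ⟨y', hy', hyy'⟩ := exists_wordDist_le_one hmem hy
    obtain ⟨p, hp, h1, -⟩ := exists_cutBoundary_between hgen hx' hzE₀
    obtain ⟨q, hq, h2, -⟩ := exists_cutBoundary_between hgen hy' hzE₀
    have h3 := wordDist_fst_le hgen hb E₀.mem_minCuts hp hq
    have h4 := wordDist_triangle hgen x x' y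
    have h5 := wordDist_triangle hgen x' y' y
    have h6 := wordDist_comm hgen y' y
    have h7 := wordDist_triangle hgen x' p.1 y'
    have h8 := wordDist_triangle hgen p.1 q.1 y'
    have h9 := wordDist_comm hgen q.1 y'
    have h10 := wordDist_triangle hgen x' x z
    have h11 := wordDist_comm hgen x' x
    have h12 := wordDist_triangle hgen y' y z
    have h13 := wordDist_comm hgen y z
    have h14 := wordDist_comm hgen p.1 z
    refine ⟨z⁻¹ • E₀, ⟨(z⁻¹ * p.1, z⁻¹ * p.2), ?_, ?_⟩, ?_⟩
    · rw [coe_smul, cutBoundary_smul]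
      exact ⟨p, hp, rfl⟩
    · rw [← wordDist_mul_left z, mul_one, mul_inv_cancel_left]
      omega
    · rw [← smul_vertex smul_le compl_smul, hE₀]

/-- The vertices of the tree have finite support. -/
theorem finite_support_star (hA : A.Finite) (hgen : Subgroup.closure A = ⊤)
    (hb : Bottleneck A c) (D : OptCut A (cutBound A c)) :
    (support (star (vertex OptCut.compl D))).Finite := by
  by_contra hinf
  have hinf : (support (star (vertex OptCut.compl D))).Infinite := hinf
  have ht := isTreePocset (K := cutBound A c) hA hgen hb
  obtain ⟨x, hx⟩ := hinf.nonempty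
  have hex : ∀ n, ∃ y ∈ support (star (vertex OptCut.compl D)), ∃ z, wordDist A x z = n ∧
      n ≤ wordDist A z y ∧ wordDist A x z + wordDist A z y = wordDist A x y := fun n => by
    obtain ⟨y, hy, hny⟩ := hinf.exists_notMem_finite (finite_wordDist_le hA hgen x (2 * n))
    rw [Set.mem_ofPred_eq, not_le] at hny
    obtain ⟨z, h1, h2⟩ := exists_wordDist_between hgen x y (i := n) (by omega)
    exact ⟨y, hy, z, h1, by omega, by omega⟩
  choose y hy z hxz hzy hxy using hex
  have hfin : (Set.range fun n => (z n)⁻¹ • vertex OptCut.compl D).Finite :=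
    (((finite_near hA hgen hb _).image _).insert _).subset
      (Set.range_subset_iff.mpr fun n => smul_vertex_mem_of_between hA hgen hb D hx (hy n) (hxy n))
  obtain ⟨w, hw⟩ := exists_infinite_fiber hfin
  obtain ⟨n₀, hn₀⟩ := hw.nonempty
  have hw' : w = vertex OptCut.compl ((z n₀)⁻¹ • D) := by
    rw [← smul_vertex smul_le compl_smul]
    exact hn₀.symm
  obtain ⟨E, u, v, hE, h1, h2⟩ := exists_isOptCut_infinite hA hgen hb
    (Y := support (star w)) fun n => by
    obtain ⟨m, hm, hnm⟩ := hw.exists_gt n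
    have hmem : ∀ x ∈ support (star (vertex OptCut.compl D)), (z m)⁻¹ * x ∈ support (star w) :=
      fun x hx => by
        rw [← hm, ← smul_star]
        exact mul_mem_support _ hx
    have hdist : ∀ a b, wordDist A ((z m)⁻¹ * a) ((z m)⁻¹ * b) = wordDist A a b :=
      wordDist_mul_left _
    have hone : ∀ a, wordDist A 1 ((z m)⁻¹ * a) = wordDist A (z m) a := fun a => by
      rw [← hdist (z m), inv_mul_cancel]
    have hcomm := wordDist_comm hgen (z m) x
    have := hxz m
    have := hzy m
    refine ⟨_, hmem _ hx, _, hmem _ (hy m), ?_, ?_, ?_⟩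
    · rw [hone]; omega
    · rw [hone]; omega
    · rw [wordDist_comm hgen _ 1, hone, hone, hdist, hcomm]
      exact hxy m
  let E' : OptCut A (cutBound A c) := ⟨E, u, v, hE⟩
  subst hw'
  by_cases hmem : E' ∈ vertex OptCut.compl ((z n₀)⁻¹ • D)
  · exact h2 (finite_support_star_inter_compl hmem)
  · have := finite_support_star_inter_compl (ht.compl_mem_vertex_iff.mpr hmem)
    rw [OptCut.compl, _root_.compl_compl] at this
    exact h1 this

theorem finite_support_pair (D : OptCut A K) : (support {D, D.compl}).Finite := by
  obtain ⟨u, v, hD⟩ := D.2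
  refine ((hD.finite.image Prod.fst).union (hD.compl.finite.image Prod.fst)).subset ?_
  rintro x ⟨F, hF | hF, q, hq⟩
  · rw [hF] at hq
    exact Or.inl ⟨_, hq, rfl⟩
  · rw [hF] at hq
    exact Or.inr ⟨_, hq, rfl⟩

end OptCut

end OptCuts

section Conclusion

variable {G : Type*} [Group G] {A : Set G} {c : ℕ}

theorem virtuallyFree_of_subsingleton [Subsingleton G] : VirtuallyFree G :=
  let := uniqueOfSubsingleton (1 : (⊤ : Subgroup G))
  ⟨⊤, inferInstance, IsFreeGroup.ofMulEquiv
    (MulEquiv.ofUnique : FreeGroup Empty ≃* (⊤ : Subgroup G))⟩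

open IsTreePocset in
/-- A group whose Cayley graph has the bottleneck property is virtually free. -/
theorem Bottleneck.virtuallyFree (hA : A.Finite) (hgen : Subgroup.closure A = ⊤)
    (hb : Bottleneck A c) : VirtuallyFree G := by
  rcases subsingleton_or_nontrivial G with hG | hG
  · exact virtuallyFree_of_subsingleton
  obtain ⟨E, hE⟩ := exists_isOptCut (c := c) hA hgen
  have : Nonempty (OptCut A (cutBound A c)) := ⟨⟨E, hE⟩⟩
  have ht := OptCut.isTreePocset (K := cutBound A c) hA hgen hb
  have hvertex : ∀ D : OptCut A (cutBound A c),
      Finite (MulAction.stabilizer G (vertex OptCut.compl D)) := fun D =>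
    OptCut.finite_stabilizer hgen (s := OptCut.star (vertex OptCut.compl D)) (D := D) rfl
      (OptCut.finite_support_star hA hgen hb D) fun h hh => by rw [OptCut.smul_star, hh]
  have hedge : ∀ D : OptCut A (cutBound A c),
      Finite (MulAction.stabilizer G ({D, D.compl} : Set (OptCut A (cutBound A c)))) := fun D =>
    OptCut.finite_stabilizer hgen (s := {D, D.compl}) (D := D) (Set.mem_insert _ _)
      (OptCut.finite_support_pair D) fun h hh => hh
  have hfin := OptCut.finite_near (K := cutBound A c) hA hgen hb 0
  let f : OptCut A (cutBound A c) → ℕ := fun D =>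
    Nat.card (MulAction.stabilizer G (vertex OptCut.compl D)) *
      Nat.card (MulAction.stabilizer G ({D, D.compl} : Set (OptCut A (cutBound A c))))
  have htrans : ∀ D : OptCut A (cutBound A c), ∃ g : G, f (g • D) ∣ ∏ F ∈ hfin.toFinset, f F :=
    fun D => by
    obtain ⟨p, hp⟩ := D.nonempty_cutBoundary hgen
    refine ⟨p.1⁻¹, Finset.dvd_prod_of_mem f ((hfin.mem_toFinset).mpr
      ⟨(p.1⁻¹ * p.1, p.1⁻¹ * p.2), ?_, ?_⟩)⟩
    · rw [OptCut.coe_smul, cutBoundary_smul]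
      exact ⟨p, hp, rfl⟩
    · rw [inv_mul_cancel, wordDist_self]
  have hcard : ∀ (g : G) (s : Set (OptCut A (cutBound A c))),
      Nat.card (MulAction.stabilizer G s) = Nat.card (MulAction.stabilizer G (g • s)) :=
    fun g s => Nat.card_congr (MulAction.stabilizerEquivStabilizer (g := g) rfl).toEquiv
  refine ht.virtuallyFree OptCut.smul_le OptCut.compl_smul
    (N := ∏ F ∈ hfin.toFinset, f F) (Finset.prod_ne_zero_iff.mpr fun F _ => ?_)
    (fun D => ?_) fun D => ?_
  · have := hvertex F
    have := hedge F
    exact mul_ne_zero Nat.card_pos.ne' Nat.card_pos.ne'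
  · obtain ⟨g, hg⟩ := htrans D
    rw [hcard g, smul_vertex OptCut.smul_le OptCut.compl_smul]
    exact (Dvd.intro _ rfl).trans hg
  · obtain ⟨g, hg⟩ := htrans D
    rw [hcard g, ← smul_pair OptCut.compl_smul]
    exact (Dvd.intro_left _ rfl).trans hg

end Conclusion

end Auxiliary

/-- A group `G` generated by a finite set `A` is virtually free if and only if there
exists `δ' ≥ 0` such that `(g₀|gₙ)_p ≥ min{(g₀|g₁)_p, …, (gₙ₋₁|gₙ)_p} − δ'` for all
`n ≥ 2` and all `g₀, …, gₙ, p ∈ G`, with respect to the word metric `d_A`. -/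
theorem virtuallyFree_iff_gromov_inequality {G : Type*} [Group G]
    (A : Set G) (hA : A.Finite) (hgen : Subgroup.closure A = ⊤) :
    VirtuallyFree G ↔
      ∃ δ' : ℝ, 0 ≤ δ' ∧ ∀ (n : ℕ), ∀ _hn : 2 ≤ n, ∀ (g : ℕ → G) (p : G),
        ((Finset.range n).inf' (Finset.nonempty_range_iff.mpr (by omega))
            fun i => gromovProdW A p (g i) (g (i + 1))) - δ'
          ≤ gromovProdW A p (g 0) (g n) := by
  constructor
  · intro hG
    obtain ⟨c, hc⟩ := hG.bottleneck hA hgen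
    exact ⟨3 * c + 1, by positivity, fun n _ g p => hc.gromov_inequality hgen _ g p⟩
  · rintro ⟨δ, -, h⟩
    exact (bottleneck_of_gromov_inequality hgen fun n _ hn => h n hn).virtuallyFree hA hgen
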